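/- arXiv:1703.10592 — 3 statements merged into one kernel-verified Lean document; each statement's English description precedes it below -/
import Mathlib

section
/- Let q be a power of an odd prime and let 𝓜_q denote the image of 𝓜 in PGL(3, 𝔽_{q²}), with H the image of the subgroup of matrices having entries a,b,c,d ∈ 𝔽_q and ad − bc = 1 (so H ≅ SL(2,q)). Let P₀' be an 𝔽_{q²}-rational point of the line ℓ : Z = 0 not lying on 𝓗_q, and let K be the subset of 𝓜_q consisting of the identity together with all elements that fix the polar line of P₀' pointwise and fix every line through P₀' (the homologies with center P₀'). Then K is a cyclic subgroup of order q+1, H ∩ K = {1}, H is normal in 𝓜_q, and 𝓜_q = H·K; that is, 𝓜_q is the internal semidirect product H ⋊ K, so 𝓜_q ≅ SL(2,q) ⋊ C_{q+1} and |𝓜_q| = q(q−1)(q+1)². -/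
open Matrix

namespace HermitianStabilizer

section Groups

/-- A subgroup `M` that is generated as a product by a normalized subgroup `H` and a cyclic
subgroup `K` of order `n` meeting `H` trivially is a semidirect product by `ZMod n`. -/
theorem exists_mulEquiv_semidirectProduct {P N : Type*} [Group P] [Group N] {M H K : Subgroup P}
    {n : ℕ} (hHM : H ≤ M) (hKM : K ≤ M) (hdisj : H ⊓ K = ⊥)
    (hnorm : ∀ g ∈ M, ∀ x ∈ H, g * x * g⁻¹ ∈ H)
    (hmul : ∀ m ∈ M, ∃ x ∈ H, ∃ k ∈ K, m = x * k)
    (e : H ≃* N) (hcyc : IsCyclic K) (hcard : Nat.card K = n) :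
    ∃ φ : Multiplicative (ZMod n) →* MulAut N,
      Nonempty (M ≃* SemidirectProduct N (Multiplicative (ZMod n)) φ) := by
  have : (H.subgroupOf M).Normal :=
    ⟨fun x hx g ↦ hnorm g g.2 x hx⟩
  have hc : (H.subgroupOf M).IsComplement' (K.subgroupOf M) := by
    refine Subgroup.isComplement'_of_disjoint_and_mul_eq_univ ?_ ?_
    · rw [disjoint_iff, Subgroup.subgroupOf, Subgroup.subgroupOf, ← Subgroup.comap_inf, hdisj,
        MonoidHom.comap_bot, Subgroup.ker_subtype]
    · refine Set.eq_univ_of_forall fun m ↦ ?_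
      obtain ⟨x, hx, k, hk, hm⟩ := hmul m m.2
      exact ⟨⟨x, hHM hx⟩, hx, ⟨k, hKM hk⟩, hk, Subtype.ext hm.symm⟩
  subst hcard
  exact ⟨_, ⟨(SemidirectProduct.mulEquivSubgroup hc).symm.trans <| SemidirectProduct.congr'
    ((Subgroup.subgroupOfEquivOfLe hHM).trans e)
    ((Subgroup.subgroupOfEquivOfLe hKM).trans (zmodCyclicMulEquiv hcyc).symm)⟩⟩

end Groups

section Cardinalities

theorem natCard_rootsOfUnity_of_dvd {F : Type*} [Field F] [Finite F] {n : ℕ}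
    (hn : n ∣ Nat.card F - 1) : Nat.card (rootsOfUnity n F) = n := by
  have h := IsCyclic.card_powMonoidHom_ker (G := Fˣ) n
  rw [Nat.card_units, Nat.gcd_eq_right hn] at h
  exact h

theorem natCard_specialLinearGroup_two {k : Type*} [Field k] [Finite k] :
    Nat.card (SpecialLinearGroup (Fin 2) k) =
      Nat.card k * (Nat.card k - 1) * (Nat.card k + 1) := by
  have := Fintype.ofFinite k
  have hker : (SpecialLinearGroup.toGL (n := Fin 2) (R := k)).range =
      (GeneralLinearGroup.det (n := Fin 2) (R := k)).ker := by
    ext A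
    constructor
    · rintro ⟨S, rfl⟩
      ext
      simp
    · intro hA
      refine ⟨⟨A.1, by simpa using congrArg Units.val hA⟩, ?_⟩
      ext
      rfl
  have hsurj : Function.Surjective (GeneralLinearGroup.det (n := Fin 2) (R := k)) := by
    intro u
    refine ⟨GeneralLinearGroup.mkOfDetNeZero !![(u : k), 0; 0, 1] (by simp), ?_⟩
    ext
    simp [GeneralLinearGroup.mkOfDetNeZero]
  have h1 := Subgroup.card_mul_index (GeneralLinearGroup.det (n := Fin 2) (R := k)).ker
  rw [Subgroup.index_ker, MonoidHom.range_eq_top.2 hsurj, Subgroup.card_top, ← hker,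
    ← Nat.card_congr (MonoidHom.ofInjective SpecialLinearGroup.toGL_injective).toEquiv,
    card_GL_field, Nat.card_units, Fin.prod_univ_two, ← Nat.card_eq_fintype_card] at h1
  have hq : 1 < Nat.card k := Finite.one_lt_card
  obtain ⟨m, hm⟩ : ∃ m, Nat.card k = m + 2 := ⟨Nat.card k - 2, by omega⟩
  rw [hm] at h1 ⊢
  simp only [Fin.val_zero, Fin.val_one, pow_zero, pow_one] at h1
  have e1 : (m + 2) ^ 2 - 1 = (m + 1) * (m + 3) := by
    rw [Nat.sub_eq_iff_eq_add (Nat.one_le_pow _ _ (by omega))]; ring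
  have e2 : (m + 2) ^ 2 - (m + 2) = (m + 1) * (m + 2) := by
    rw [Nat.sub_eq_iff_eq_add (Nat.le_self_pow (by omega) _)]; ring
  have e3 : m + 2 - 1 = m + 1 := rfl
  rw [e1, e2, e3] at h1
  rw [e3]
  refine Nat.eq_of_mul_eq_mul_right (by omega : 0 < m + 1) (h1.trans ?_)
  ring

/-- The fixed field of `x ↦ x ^ q` in a field with `q ^ 2` elements has `q` elements. -/
theorem natCard_subfield_of_mem_iff {F : Type*} [Field F] [Finite F] {q : ℕ} (hq : 1 < q)
    (hF : Nat.card F = q ^ 2) (k : Subfield F) (hk : ∀ x, x ∈ k ↔ x ^ q = x) :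
    Nat.card k = q := by
  have hdvd : q - 1 ∣ Nat.card F - 1 := by
    rw [hF]
    simpa using Nat.sub_dvd_pow_sub_pow q 1 2
  have e : kˣ ≃ rootsOfUnity (q - 1) F :=
    { toFun := fun u ↦ ⟨Units.map k.subtype u, by
        rw [mem_rootsOfUnity']
        have hu : (u : F) ≠ 0 := by simp
        have h := (hk u).1 u.1.2
        refine mul_right_cancel₀ hu ?_
        rw [one_mul]
        exact (pow_sub_one_mul (by omega) _).trans h⟩
      invFun := fun u ↦ Units.mk0 ⟨(u : Fˣ), by
        rw [hk, ← pow_sub_one_mul (by omega : q ≠ 0), (mem_rootsOfUnity' _ _).1 u.2, one_mul]⟩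
        (fun h ↦ u.1.ne_zero (congrArg Subtype.val h))
      left_inv := fun u ↦ by ext; rfl
      right_inv := fun u ↦ by ext; rfl }
  have h := Nat.card_congr e
  rw [Nat.card_units, natCard_rootsOfUnity_of_dvd hdvd] at h
  have : 1 < Nat.card k := Finite.one_lt_card
  omega

end Cardinalities

section Embedding

variable {F : Type*} [Field F]

/-- The embedding of `2 × 2` matrices as upper left blocks of `3 × 3` matrices. -/
def blockHom (F : Type*) [Field F] :
    Matrix (Fin 2) (Fin 2) F →* Matrix (Fin 3) (Fin 3) F where
  toFun A := !![A 0 0, A 0 1, 0; A 1 0, A 1 1, 0; 0, 0, 1]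
  map_one' := by
    ext i j
    fin_cases i <;> fin_cases j <;> simp
  map_mul' A B := by
    ext i j
    fin_cases i <;> fin_cases j <;> simp [Matrix.mul_apply, Fin.sum_univ_succ]

theorem blockHom_apply (A : Matrix (Fin 2) (Fin 2) F) :
    blockHom F A = !![A 0 0, A 0 1, 0; A 1 0, A 1 1, 0; 0, 0, 1] := rfl

/-- The embedding `GL(2, F) → PGL(3, F)` by upper left blocks. -/
def planeHom (F : Type*) [Field F] :
    GL (Fin 2) F →* GL (Fin 3) F ⧸ Subgroup.center (GL (Fin 3) F) :=
  (QuotientGroup.mk' _).comp (Units.map (blockHom F))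

theorem planeHom_apply (A : GL (Fin 2) F) :
    planeHom F A = QuotientGroup.mk (Units.map (blockHom F) A) := rfl

theorem planeHom_injective : Function.Injective (planeHom F) := by
  rw [injective_iff_map_eq_one]
  intro A hA
  have hA' := (QuotientGroup.eq_one_iff _).1 hA
  rw [GeneralLinearGroup.mem_center_iff_val_mem_range_scalar] at hA'
  obtain ⟨c, hc⟩ := hA'
  have key : ∀ i j, (Matrix.scalar (Fin 3) c) i j = blockHom F A i j := fun i j ↦ by
    rw [hc]; rfl
  have h00 := key 0 0
  have h01 := key 0 1
  have h10 := key 1 0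
  have h11 := key 1 1
  have h22 := key 2 2
  simp [blockHom_apply, Matrix.diagonal] at h00 h01 h10 h11 h22
  ext i j
  fin_cases i <;> fin_cases j <;> simp [← h00, ← h01, ← h10, ← h11, h22]

theorem mk_eq_planeHom {g : GL (Fin 3) F} {A : GL (Fin 2) F}
    (h : QuotientGroup.mk g = planeHom F A) :
    ∃ r : F, r ≠ 0 ∧ (g : Matrix (Fin 3) (Fin 3) F) = r • blockHom F A := by
  have h' := QuotientGroup.eq.1 (h.symm.trans rfl)
  rw [GeneralLinearGroup.mem_center_iff_val_mem_range_scalar] at h'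
  obtain ⟨r, hr⟩ := h'
  have hg : (g : Matrix (Fin 3) (Fin 3) F) = r • blockHom F A := by
    have : g = Units.map (blockHom F) A * ((Units.map (blockHom F) A)⁻¹ * g) := by group
    rw [this, Units.val_mul, ← hr, Matrix.scalar_apply, ← Matrix.smul_one_eq_diagonal,
      Matrix.mul_smul, mul_one]
    rfl
  refine ⟨r, ?_, hg⟩
  rintro rfl
  exact g.ne_zero (by rw [hg, zero_smul])

theorem exists_units_map_blockHom {g : GL (Fin 3) F} {a b c d : F}
    (hg : (g : Matrix (Fin 3) (Fin 3) F) = !![a, b, 0; c, d, 0; 0, 0, 1]) :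
    ∃ A : GL (Fin 2) F, (A : Matrix (Fin 2) (Fin 2) F) = !![a, b; c, d] ∧
      g = Units.map (blockHom F) A := by
  have hdet : (g : Matrix (Fin 3) (Fin 3) F).det ≠ 0 := g.det_ne_zero
  have hdet' : (!![a, b; c, d] : Matrix (Fin 2) (Fin 2) F).det ≠ 0 := by
    rw [hg] at hdet
    simpa [Matrix.det_fin_three, Matrix.det_fin_two] using hdet
  refine ⟨GeneralLinearGroup.mkOfDetNeZero _ hdet', rfl, ?_⟩
  ext : 1
  rw [hg]
  rfl

end Embedding

section Unitary

variable {F : Type*} [Field F]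

theorem unitary_iff {a b c d a' b' c' d' : F} (hD : a * d - b * c ≠ 0) :
    (a * c' - a' * c = 0 ∧ b * d' - b' * d = 0 ∧ b * c' - a' * d = -1 ∧ a * d' - b' * c = 1) ↔
      (a * d - b * c) * a' = a ∧ (a * d - b * c) * b' = b ∧ (a * d - b * c) * c' = c ∧
        (a * d - b * c) * d' = d := by
  constructor
  · rintro ⟨h1, h2, h3, h4⟩
    refine ⟨?_, ?_, ?_, ?_⟩
    · linear_combination b * h1 - a * h3
    · linear_combination b * h4 - a * h2
    · linear_combination d * h1 - c * h3
    · linear_combination d * h4 - c * h2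
  · rintro ⟨h1, h2, h3, h4⟩
    refine ⟨?_, ?_, ?_, ?_⟩ <;> refine mul_left_cancel₀ hD ?_
    · linear_combination a * h3 - c * h1
    · linear_combination b * h4 - d * h2
    · linear_combination b * h3 - d * h1
    · linear_combination a * h4 - c * h2

/-- The matrix multiplying `(x, y)` by `t` and fixing the kernel of the functional `(f, g)`. -/
def homologyHom {x y f g : F} (hfg : f * x + g * y = 1) : Fˣ →* GL (Fin 2) F :=
  MonoidHom.toHomUnits
    { toFun := fun t ↦ !![1 + (t - 1) * (x * f), (t - 1) * (x * g);
        (t - 1) * (y * f), 1 + (t - 1) * (y * g)]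
      map_one' := by simp [Matrix.one_fin_two]
      map_mul' := fun s t ↦ by
        ext i j
        fin_cases i <;> fin_cases j <;> simp [Matrix.mul_apply, Fin.sum_univ_succ]
        · linear_combination (-(s - 1) * (t - 1) * x * f : F) * hfg
        · linear_combination (-(s - 1) * (t - 1) * x * g : F) * hfg
        · linear_combination (-(s - 1) * (t - 1) * y * f : F) * hfg
        · linear_combination (-(s - 1) * (t - 1) * y * g : F) * hfg }

theorem coe_homologyHom {x y f g : F} (hfg : f * x + g * y = 1) (t : Fˣ) :
    (homologyHom hfg t : Matrix (Fin 2) (Fin 2) F) =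
      !![1 + (t - 1) * (x * f), (t - 1) * (x * g);
        (t - 1) * (y * f), 1 + (t - 1) * (y * g)] := rfl

theorem det_homologyHom {x y f g : F} (hfg : f * x + g * y = 1) (t : Fˣ) :
    (homologyHom hfg t : Matrix (Fin 2) (Fin 2) F).det = t := by
  rw [coe_homologyHom, Matrix.det_fin_two_of]
  linear_combination (t - 1 : F) * hfg

/-- The embedding `SL(2, k) → GL(2, F)` for a subfield `k` of `F`. -/
def subfieldHom (k : Subfield F) : SpecialLinearGroup (Fin 2) k →* GL (Fin 2) F :=
  SpecialLinearGroup.toGL.comp (SpecialLinearGroup.map k.subtype)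

theorem coe_subfieldHom (k : Subfield F) (S : SpecialLinearGroup (Fin 2) k) (i j : Fin 2) :
    (subfieldHom k S : Matrix (Fin 2) (Fin 2) F) i j = (S i j : F) := rfl

theorem det_subfieldHom (k : Subfield F) (S : SpecialLinearGroup (Fin 2) k) :
    (subfieldHom k S : Matrix (Fin 2) (Fin 2) F).det = 1 :=
  (SpecialLinearGroup.map k.subtype S).2

theorem subfieldHom_injective (k : Subfield F) : Function.Injective (subfieldHom k) := by
  intro S T h
  ext i j
  have := congrArg (fun A : GL (Fin 2) F ↦ A i j) h
  exact this

theorem exists_subfieldHom_eq {k : Subfield F} {A : GL (Fin 2) F}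
    (hdet : (A : Matrix (Fin 2) (Fin 2) F).det = 1) (hA : ∀ i j, A i j ∈ k) :
    ∃ S, subfieldHom k S = A := by
  refine ⟨⟨Matrix.of fun i j ↦ ⟨A i j, hA i j⟩, ?_⟩, ?_⟩
  · apply Subtype.ext
    rw [Matrix.det_fin_two] at hdet ⊢
    exact hdet
  · ext i j
    rfl

variable (σ : F →+* F)

/-- The matrices preserving `x₁ σ(y₂) - y₁ σ(x₂)` are those with `σ(A) = A / det A`. -/
def IsSkewUnitary (A : GL (Fin 2) F) : Prop :=
  ∀ i j, (A : Matrix (Fin 2) (Fin 2) F).det * σ (A i j) = A i j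

variable {σ}

theorem isSkewUnitary_iff {A : GL (Fin 2) F} :
    IsSkewUnitary σ A ↔ A 0 0 * σ (A 1 0) - σ (A 0 0) * A 1 0 = 0 ∧
      A 0 1 * σ (A 1 1) - σ (A 0 1) * A 1 1 = 0 ∧
      A 0 1 * σ (A 1 0) - σ (A 0 0) * A 1 1 = -1 ∧
      A 0 0 * σ (A 1 1) - σ (A 0 1) * A 1 0 = 1 := by
  have hdet : (A : Matrix (Fin 2) (Fin 2) F).det ≠ 0 := A.det_ne_zero
  rw [Matrix.det_fin_two] at hdet
  rw [unitary_iff hdet, IsSkewUnitary, Matrix.det_fin_two]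
  simp [Fin.forall_fin_two, and_assoc]

theorem IsSkewUnitary.det_mul_map_det {A : GL (Fin 2) F} (hA : IsSkewUnitary σ A) :
    (A : Matrix (Fin 2) (Fin 2) F).det * σ (A : Matrix (Fin 2) (Fin 2) F).det = 1 := by
  have hdet : (A : Matrix (Fin 2) (Fin 2) F).det ≠ 0 := A.det_ne_zero
  refine mul_left_cancel₀ hdet ?_
  have h00 := hA 0 0
  have h01 := hA 0 1
  have h10 := hA 1 0
  have h11 := hA 1 1
  set D := (A : Matrix (Fin 2) (Fin 2) F).det with hD
  have e : D = A 0 0 * A 1 1 - A 0 1 * A 1 0 := Matrix.det_fin_two _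
  have e' : σ D = σ (A 0 0) * σ (A 1 1) - σ (A 0 1) * σ (A 1 0) := by
    rw [e, map_sub, map_mul, map_mul]
  rw [e', mul_one]
  calc D * (D * (σ (A 0 0) * σ (A 1 1) - σ (A 0 1) * σ (A 1 0)))
      = (D * σ (A 0 0)) * (D * σ (A 1 1)) - (D * σ (A 0 1)) * (D * σ (A 1 0)) := by ring
    _ = D := by rw [h00, h01, h10, h11, e]

theorem IsSkewUnitary.mem_of_det_eq_one {A : GL (Fin 2) F} (hA : IsSkewUnitary σ A)
    (hdet : (A : Matrix (Fin 2) (Fin 2) F).det = 1) {k : Subfield F}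
    (hk : ∀ x, x ∈ k ↔ σ x = x) (i j : Fin 2) : A i j ∈ k := by
  rw [hk]
  simpa [hdet] using hA i j

theorem isSkewUnitary_subfieldHom {k : Subfield F} (hk : ∀ x, x ∈ k ↔ σ x = x)
    (S : SpecialLinearGroup (Fin 2) k) : IsSkewUnitary σ (subfieldHom k S) := by
  intro i j
  rw [det_subfieldHom, one_mul]
  exact (hk _).1 (S i j).2

section Homology

variable {x y : F}

theorem functional_apply_eq_one (hN : x * σ y - y * σ x ≠ 0) :
    σ y / (x * σ y - y * σ x) * x + -σ x / (x * σ y - y * σ x) * y = 1 := by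
  rw [div_mul_eq_mul_div, div_mul_eq_mul_div, ← add_div, div_eq_one_iff_eq hN]
  ring

variable (hN : x * σ y - y * σ x ≠ 0)

theorem isSkewUnitary_homologyHom (hσ : ∀ z, σ (σ z) = z) {t : Fˣ} (ht : (t : F) * σ t = 1) :
    IsSkewUnitary σ (homologyHom (functional_apply_eq_one hN) t) := by
  have hN' : σ (x * σ y - y * σ x) = -(x * σ y - y * σ x) := by
    simp only [map_sub, map_mul, hσ]
    ring
  intro i j
  rw [det_homologyHom, coe_homologyHom]
  set N := x * σ y - y * σ x with hNdef
  fin_cases i <;> fin_cases j <;> simp [hN', hσ] <;> field_simp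
  · linear_combination (N - x * σ y) * ht + (t - 1 : F) * hNdef
  · linear_combination (x * σ x) * ht
  · linear_combination (-(y * σ y)) * ht
  · linear_combination (N + y * σ x) * ht + (t - 1 : F) * hNdef

theorem blockHom_homologyHom_mulVec (t : Fˣ) (v : Fin 3 → F) :
    (blockHom F (homologyHom (functional_apply_eq_one hN) t)).mulVec v =
      v + ((t - 1) * ((v 0 * σ y - v 1 * σ x) / (x * σ y - y * σ x))) • ![x, y, 0] := by
  rw [blockHom_apply, coe_homologyHom]
  ext i
  fin_cases i <;> simp [Matrix.mulVec, dotProduct, Fin.sum_univ_succ] <;> ring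

theorem eq_homologyHom {A : GL (Fin 2) F} {t : Fˣ}
    (h0 : A 0 0 * x + A 0 1 * y = t * x) (h1 : A 1 0 * x + A 1 1 * y = t * y)
    (h2 : A 0 0 * σ x + A 0 1 * σ y = σ x) (h3 : A 1 0 * σ x + A 1 1 * σ y = σ y) :
    A = homologyHom (functional_apply_eq_one hN) t := by
  ext i j
  rw [coe_homologyHom]
  set N := x * σ y - y * σ x with hNdef
  fin_cases i <;> fin_cases j <;> simp <;> field_simp
  · linear_combination σ y * h0 - y * h2 + (A 0 0 - 1 : F) * hNdef
  · linear_combination x * h2 - σ x * h0 + A 0 1 * hNdef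
  · linear_combination σ y * h1 - y * h3 + A 1 0 * hNdef
  · linear_combination x * h3 - σ x * h1 + (A 1 1 - 1 : F) * hNdef

/-- Elements of `PGL(3, F)` induced by a skew-unitary matrix that fix the polar line of
`(x, y, 0)` pointwise and fix every line through that point are homologies. -/
theorem eq_homologyHom_of_fixes (hσ : ∀ z, σ (σ z) = z) {A : GL (Fin 2) F}
    {g : GL (Fin 3) F} (hg : QuotientGroup.mk g = planeHom F A)
    (hpolar : ∀ v : Fin 3 → F, x * σ (v 1) - y * σ (v 0) = 0 →
      ∃ c : F, (g : Matrix (Fin 3) (Fin 3) F).mulVec v = c • v)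
    (hlines : (g : Matrix (Fin 3) (Fin 3) F).mulVec ![x, y, 0] ∈
      Submodule.span F {![x, y, 0]}) :
    ∃ t : Fˣ, A = homologyHom (functional_apply_eq_one hN) t := by
  obtain ⟨r, hr, hgr⟩ := mk_eq_planeHom hg
  obtain ⟨c, hc⟩ := hpolar ![σ x, σ y, 1] (by simp [hσ]; ring)
  obtain ⟨m, hm⟩ := Submodule.mem_span_singleton.1 hlines
  rw [hgr, blockHom_apply] at hc hm
  have hc0 := congrFun hc 0
  have hc1 := congrFun hc 1
  have hc2 := congrFun hc 2
  have hm0 := congrFun hm 0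
  have hm1 := congrFun hm 1
  simp [Matrix.mulVec, dotProduct, Fin.sum_univ_succ] at hc0 hc1 hc2 hm0 hm1
  subst hc2
  have h0 : A 0 0 * x + A 0 1 * y = m / r * x := by
    field_simp
    linear_combination -hm0
  have h1 : A 1 0 * x + A 1 1 * y = m / r * y := by
    field_simp
    linear_combination -hm1
  have h2 : A 0 0 * σ x + A 0 1 * σ y = σ x :=
    mul_left_cancel₀ hr (by linear_combination hc0)
  have h3 : A 1 0 * σ x + A 1 1 * σ y = σ y :=
    mul_left_cancel₀ hr (by linear_combination hc1)
  have hdet : m / r = (A : Matrix (Fin 2) (Fin 2) F).det := by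
    refine mul_right_cancel₀ hN ?_
    rw [Matrix.det_fin_two]
    linear_combination (A 0 0 * σ x + A 0 1 * σ y) * h1 - (A 1 0 * σ x + A 1 1 * σ y) * h0
      + m / r * y * h2 - m / r * x * h3
  rw [hdet] at h0 h1
  exact ⟨GeneralLinearGroup.det A, eq_homologyHom hN h0 h1 h2 h3⟩

end Homology

end Unitary

end HermitianStabilizer

open HermitianStabilizer

/-- Let `q` be a power of an odd prime, `𝓜_q` the image in
`PGL(3,𝔽_{q²})` of the matrix group `𝓜`, and `H ≅ SL(2,q)` the image of the subgroup of
matrices with entries `a,b,c,d ∈ 𝔽_q` and `ad-bc = 1`.  Let `P₀'` be an `𝔽_{q²}`-rational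
point of `ℓ : Z = 0` off `𝓗_q`, and `K` the subset of `𝓜_q` consisting of the identity
together with all homologies with center `P₀'` (elements fixing the polar line of `P₀'`
pointwise and fixing every line through `P₀'`).  Then `K` is a cyclic subgroup of order
`q+1`, `H ∩ K = {1}`, `H ⊴ 𝓜_q`, and `𝓜_q = H·K`; hence `𝓜_q ≅ SL(2,q) ⋊ C_{q+1}` and
`|𝓜_q| = q(q-1)(q+1)²`. -/
theorem stmt_3 (p : ℕ) (hp : p.Prime) (hodd : p ≠ 2) (h : ℕ) (hh : 1 ≤ h)
    (q : ℕ) (hq : q = p ^ h)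
    (F : Type) [Field F] [Fintype F] (hF : Fintype.card F = q ^ 2)
    (Fq : Subfield F) (hFq : ∀ x : F, x ∈ Fq ↔ x ^ q = x)
    (ω : F) (hω : ω ^ (q - 1) = -1)
    -- the subgroups `𝓜_q` and `H` of `PGL(3,𝔽_{q²})`
    (Mq Hq : Subgroup (Matrix.GeneralLinearGroup (Fin 3) F ⧸
      Subgroup.center (Matrix.GeneralLinearGroup (Fin 3) F)))
    (hMq : ∀ gbar, gbar ∈ Mq ↔ ∃ g : Matrix.GeneralLinearGroup (Fin 3) F,
      gbar = QuotientGroup.mk g ∧ ∃ a b c d : F,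
        (g : Matrix (Fin 3) (Fin 3) F) = !![a, b, 0; c, d, 0; 0, 0, 1] ∧
        a * c ^ q - a ^ q * c = 0 ∧ b * d ^ q - b ^ q * d = 0 ∧
        b * c ^ q - a ^ q * d = -1 ∧ a * d ^ q - b ^ q * c = 1)
    (hHq : ∀ gbar, gbar ∈ Hq ↔ ∃ g : Matrix.GeneralLinearGroup (Fin 3) F,
      gbar = QuotientGroup.mk g ∧ ∃ a b c d : F,
        (g : Matrix (Fin 3) (Fin 3) F) = !![a, b, 0; c, d, 0; 0, 0, 1] ∧
        a ∈ Fq ∧ b ∈ Fq ∧ c ∈ Fq ∧ d ∈ Fq ∧ a * d - b * c = 1)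
    -- the point `P₀'`: an `𝔽_{q²}`-rational point of `ℓ` not on `𝓗_q`
    (P₀' : Fin 3 → F) (hP0 : P₀' ≠ 0) (hP0l : P₀' 2 = 0)
    (hP0off : P₀' 0 * P₀' 1 ^ q - P₀' 1 * P₀' 0 ^ q + ω * P₀' 2 ^ (q + 1) ≠ 0)
    -- `K`: the identity together with the homologies of `𝓜_q` with center `P₀'`
    (Kset : Set (Matrix.GeneralLinearGroup (Fin 3) F ⧸
      Subgroup.center (Matrix.GeneralLinearGroup (Fin 3) F)))
    (hKset : Kset = {gbar | gbar ∈ Mq ∧ (gbar = 1 ∨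
      ∃ g : Matrix.GeneralLinearGroup (Fin 3) F, gbar = QuotientGroup.mk g ∧
        -- fixes the polar line of `P₀'` pointwise
        (∀ v : Fin 3 → F,
          P₀' 0 * v 1 ^ q - P₀' 1 * v 0 ^ q + ω * P₀' 2 * v 2 ^ q = 0 →
          ∃ c : F, (g : Matrix (Fin 3) (Fin 3) F).mulVec v = c • v) ∧
        -- fixes every line through `P₀'`
        (∀ u : Fin 3 → F,
          (g : Matrix (Fin 3) (Fin 3) F).mulVec u ∈ Submodule.span F {P₀', u}))}) :
    ∃ Ksub : Subgroup (Matrix.GeneralLinearGroup (Fin 3) F ⧸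
        Subgroup.center (Matrix.GeneralLinearGroup (Fin 3) F)),
      (Ksub : Set (Matrix.GeneralLinearGroup (Fin 3) F ⧸
        Subgroup.center (Matrix.GeneralLinearGroup (Fin 3) F))) = Kset ∧
      IsCyclic Ksub ∧ Nat.card Ksub = q + 1 ∧
      Hq ≤ Mq ∧ Ksub ≤ Mq ∧
      Hq ⊓ Ksub = ⊥ ∧
      (∀ g ∈ Mq, ∀ x ∈ Hq, g * x * g⁻¹ ∈ Hq) ∧
      (∀ m ∈ Mq, ∃ x ∈ Hq, ∃ k ∈ Ksub, m = x * k) ∧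
      Nonempty (Hq ≃* Matrix.SpecialLinearGroup (Fin 2) Fq) ∧
      (∃ φ : Multiplicative (ZMod (q + 1)) →*
          MulAut (Matrix.SpecialLinearGroup (Fin 2) Fq),
        Nonempty (Mq ≃* SemidirectProduct (Matrix.SpecialLinearGroup (Fin 2) Fq)
          (Multiplicative (ZMod (q + 1))) φ)) ∧
      Nat.card Mq = q * (q - 1) * (q + 1) ^ 2 := by
  have hq1 : 1 < q := hq ▸ Nat.one_lt_pow (by omega) hp.one_lt
  have hFcard : Nat.card F = q ^ 2 := by rw [Nat.card_eq_fintype_card, hF]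
  -- the `q`-th power map as a ring endomorphism
  have : Fact p.Prime := ⟨hp⟩
  have : CharP F p := charP_of_card_eq_prime_pow (f := h * 2) (by rw [hF, hq, pow_mul])
  obtain ⟨σ, hσq⟩ : ∃ σ : F →+* F, ∀ z, σ z = z ^ q :=
    ⟨iterateFrobenius F p h, fun z ↦ by rw [iterateFrobenius_def, hq]⟩
  have hσ : ∀ z, σ (σ z) = z := fun z ↦ by
    rw [hσq, hσq, ← pow_mul, ← sq, ← hF, FiniteField.pow_card]
  have hk : ∀ z, z ∈ Fq ↔ σ z = z := fun z ↦ by rw [hFq, hσq]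
  simp only [← hσq] at hMq hP0off hKset
  obtain ⟨x, y, rfl⟩ : ∃ x y, P₀' = ![x, y, 0] := by
    refine ⟨P₀' 0, P₀' 1, ?_⟩
    ext i
    fin_cases i <;> simp [hP0l]
  have hN : x * σ y - y * σ x ≠ 0 := by simpa using hP0off
  -- explicit descriptions of the three groups
  have hM : ∀ gbar, gbar ∈ Mq ↔ ∃ A, IsSkewUnitary σ A ∧ planeHom F A = gbar := by
    intro gbar
    rw [hMq]
    constructor
    · rintro ⟨g, rfl, a, b, c, d, hg, hU⟩
      obtain ⟨A, hA, rfl⟩ := exists_units_map_blockHom hg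
      exact ⟨A, isSkewUnitary_iff.2 (by simpa [hA] using hU), rfl⟩
    · rintro ⟨A, hA, rfl⟩
      exact ⟨Units.map (blockHom F) A, rfl, _, _, _, _, rfl, isSkewUnitary_iff.1 hA⟩
  have hH : Hq = ((planeHom F).comp (subfieldHom Fq)).range := by
    ext gbar
    rw [hHq]
    constructor
    · rintro ⟨g, rfl, a, b, c, d, hg, ha, hb, hc, hd, hdet⟩
      obtain ⟨A, hA, rfl⟩ := exists_units_map_blockHom hg
      obtain ⟨S, rfl⟩ := exists_subfieldHom_eq (k := Fq) (A := A)
        (by rw [hA, Matrix.det_fin_two_of, hdet])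
        (by simp [hA, Fin.forall_fin_two, ha, hb, hc, hd])
      exact ⟨S, rfl⟩
    · rintro ⟨S, rfl⟩
      refine ⟨Units.map (blockHom F) (subfieldHom Fq S), rfl, _, _, _, _, rfl,
        (S 0 0).2, (S 0 1).2, (S 1 0).2, (S 1 1).2, ?_⟩
      rw [← det_subfieldHom Fq S, Matrix.det_fin_two]
  have hroots : ∀ t : Fˣ, t ∈ rootsOfUnity (q + 1) F ↔ (t : F) * σ t = 1 := fun t ↦ by
    rw [mem_rootsOfUnity', hσq, pow_succ']
  set κ : rootsOfUnity (q + 1) F →* GL (Fin 2) F :=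
    (homologyHom (functional_apply_eq_one hN)).comp (rootsOfUnity (q + 1) F).subtype
  have hκdet : ∀ t, (κ t : Matrix (Fin 2) (Fin 2) F).det = ((t : Fˣ) : F) := fun t ↦
    det_homologyHom (functional_apply_eq_one hN) _
  have hκU : ∀ t, IsSkewUnitary σ (κ t) := fun t ↦
    isSkewUnitary_homologyHom hN hσ ((hroots _).1 t.2)
  have hκinj : Function.Injective κ := fun s t hst ↦ by
    ext
    rw [← hκdet, hst, hκdet]
  have hHM : Hq ≤ Mq := by
    rw [hH]
    rintro _ ⟨S, rfl⟩
    exact (hM _).2 ⟨_, isSkewUnitary_subfieldHom hk S, rfl⟩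
  have hKM : ((planeHom F).comp κ).range ≤ Mq := by
    rintro _ ⟨t, rfl⟩
    exact (hM _).2 ⟨_, hκU t, rfl⟩
  have hMdet : ∀ A, planeHom F A ∈ Mq → (A : Matrix (Fin 2) (Fin 2) F).det = 1 →
      planeHom F A ∈ Hq := by
    intro A hA hdet
    obtain ⟨B, hB, hBA⟩ := (hM _).1 hA
    obtain rfl := planeHom_injective hBA
    obtain ⟨S, rfl⟩ := exists_subfieldHom_eq hdet (hB.mem_of_det_eq_one hdet hk)
    exact hH ▸ ⟨S, rfl⟩
  have hcyc : IsCyclic ((planeHom F).comp κ).range :=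
    isCyclic_of_surjective _ ((planeHom F).comp κ).rangeRestrict_surjective
  have hKcard : Nat.card ((planeHom F).comp κ).range = q + 1 := by
    rw [← Nat.card_congr (MonoidHom.ofInjective
      (planeHom_injective.comp hκinj : Function.Injective ((planeHom F).comp κ))).toEquiv]
    refine natCard_rootsOfUnity_of_dvd ?_
    rw [hFcard]
    exact ⟨q - 1, by simpa using Nat.sq_sub_sq q 1⟩
  have hdisj : Hq ⊓ ((planeHom F).comp κ).range = ⊥ := by
    rw [hH, eq_bot_iff]
    rintro _ ⟨⟨S, rfl⟩, t, ht⟩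
    have hSt : κ t = subfieldHom Fq S := planeHom_injective ht
    have ht1 : t = 1 := by
      ext
      rw [← hκdet, hSt, det_subfieldHom]
      rfl
    rw [Subgroup.mem_bot, ← ht, ht1, map_one]
  have hnorm : ∀ g ∈ Mq, ∀ z ∈ Hq, g * z * g⁻¹ ∈ Hq := by
    intro g hg z hz
    have hgz := Mq.mul_mem (Mq.mul_mem hg (hHM hz)) (Mq.inv_mem hg)
    obtain ⟨A, -, rfl⟩ := (hM _).1 hg
    rw [hH] at hz
    obtain ⟨S, rfl⟩ := hz
    rw [MonoidHom.comp_apply, ← map_inv, ← map_mul, ← map_mul] at hgz ⊢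
    refine hMdet _ hgz ?_
    have : GeneralLinearGroup.det (A * subfieldHom Fq S * A⁻¹) = 1 := by
      rw [map_mul, map_mul, map_inv, mul_comm, inv_mul_cancel_left]
      ext
      exact det_subfieldHom Fq S
    exact congrArg Units.val this
  have hmul : ∀ m ∈ Mq, ∃ z ∈ Hq, ∃ k ∈ ((planeHom F).comp κ).range, m = z * k := by
    intro m hm
    obtain ⟨A, hA, rfl⟩ := (hM _).1 hm
    let t : rootsOfUnity (q + 1) F :=
      ⟨GeneralLinearGroup.det A, (hroots _).2 hA.det_mul_map_det⟩
    refine ⟨planeHom F (A * (κ t)⁻¹), hMdet _ ?_ ?_, planeHom F (κ t), ⟨t, rfl⟩, ?_⟩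
    · rw [map_mul, map_inv]
      exact Mq.mul_mem hm (Mq.inv_mem (hKM ⟨t, rfl⟩))
    · have : GeneralLinearGroup.det (A * (κ t)⁻¹) = 1 := by
        rw [map_mul, map_inv, mul_inv_eq_one]
        ext
        exact (hκdet t).symm
      exact congrArg Units.val this
    · rw [← map_mul, inv_mul_cancel_right]
  have e : Hq ≃* SpecialLinearGroup (Fin 2) Fq :=
    (MulEquiv.subgroupCongr hH).trans (MonoidHom.ofInjective
      (planeHom_injective.comp (subfieldHom_injective Fq) :
        Function.Injective ((planeHom F).comp (subfieldHom Fq)))).symm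
  obtain ⟨φ, ⟨E⟩⟩ :=
    exists_mulEquiv_semidirectProduct hHM hKM hdisj hnorm hmul e hcyc hKcard
  refine ⟨((planeHom F).comp κ).range, ?_, hcyc, hKcard, hHM, hKM, hdisj, hnorm, hmul, ⟨e⟩,
    ⟨φ, ⟨E⟩⟩, ?_⟩
  · rw [hKset]
    ext gbar
    constructor
    · rintro ⟨t, rfl⟩
      refine ⟨hKM ⟨t, rfl⟩, Or.inr ⟨Units.map (blockHom F) (κ t), rfl, fun v hv ↦ ⟨1, ?_⟩,
        fun u ↦ ?_⟩⟩
      · have hv' : v 0 * σ y - v 1 * σ x = 0 := by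
          have := congrArg σ hv
          simp [hσ] at this
          linear_combination -this
        refine (blockHom_homologyHom_mulVec hN t v).trans ?_
        rw [hv', zero_div, mul_zero, zero_smul, add_zero, one_smul]
      · refine (blockHom_homologyHom_mulVec hN t u).symm ▸ ?_
        exact Submodule.add_mem _ (Submodule.subset_span (by simp))
          (Submodule.smul_mem _ _ (Submodule.subset_span (by simp)))
    · rintro ⟨hgM, rfl | ⟨g, rfl, hpolar, hlines⟩⟩
      · exact one_mem _
      · obtain ⟨A, hA, hAg⟩ := (hM _).1 hgM
        obtain ⟨t, rfl⟩ := eq_homologyHom_of_fixes hN hσ hAg.symm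
          (fun v hv ↦ hpolar v (by simpa using hv)) (by simpa using hlines ![x, y, 0])
        have ht := hA.det_mul_map_det
        rw [det_homologyHom] at ht
        exact ⟨⟨t, (hroots t).2 ht⟩, hAg⟩
  · rw [Nat.card_congr E.toEquiv, SemidirectProduct.card, natCard_specialLinearGroup_two,
      natCard_subfield_of_mem_iff hq1 hFcard Fq hFq, Nat.card_congr Multiplicative.toAdd,
      Nat.card_zmod]
    ring
end

section
/- Let q be a power of an odd prime and let τ ∈ PGU(3,q) be the involution induced by the diagonal matrix diag(−1,−1,1). Then the stabilizer of the point P₀ = (0:0:1) in PGU(3,q) equals the centralizer C_{PGU(3,q)}(τ), which moreover equals the normalizer N_{PGU(3,q)}(⟨τ⟩); this stabilizer is the image in PGL(3, 𝔽_{q²}) of the matrix group 𝓜 and has order q(q−1)(q+1)². -/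
open Matrix

/-- The Hermitian polynomial `X Y^q - Y X^q + ω Z^(q+1)` evaluated at a vector. -/
def hermEval (q : ℕ) {K : Type} [Field K] (ω : K) (v : Fin 3 → K) : K :=
  v 0 * v 1 ^ q - v 1 * v 0 ^ q + ω * v 2 ^ (q + 1)

/-- The conditions on `a, b, c, d` defining the block matrices of `𝓜`. -/
structure HermBlock (q : ℕ) {F : Type*} [Field F] (a b c d : F) : Prop where
  isotropic_left : a * c ^ q - a ^ q * c = 0
  isotropic_right : b * d ^ q - b ^ q * d = 0
  cross_left : b * c ^ q - a ^ q * d = -1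
  cross_right : a * d ^ q - b ^ q * c = 1

section Frobenius

variable {q : ℕ} {F : Type*} [Field F]

namespace HermBlock

variable {a b c d : F}

theorem det_ne_zero (H : HermBlock q a b c d) : a * d - b * c ≠ 0 := by
  intro h0
  have : (a * d - b * c) * (a ^ q * d ^ q - b ^ q * c ^ q) = 1 := by
    linear_combination (b * d ^ q - b ^ q * d) * H.isotropic_left
      - (a * d ^ q - b ^ q * c) * H.cross_left + H.cross_right
  rw [h0, zero_mul] at this
  exact zero_ne_one this

theorem form_eq (H : HermBlock q a b c d) (hadd : ∀ x y : F, (x + y) ^ q = x ^ q + y ^ q)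
    (x y : F) :
    (a * x + b * y) * (c * x + d * y) ^ q - (c * x + d * y) * (a * x + b * y) ^ q
      = x * y ^ q - y * x ^ q := by
  simp only [hadd, mul_pow]
  linear_combination x * x ^ q * H.isotropic_left + y * y ^ q * H.isotropic_right
    + y * x ^ q * H.cross_left + x * y ^ q * H.cross_right

theorem map {K : Type*} [Field K] (f : F →+* K) (H : HermBlock q a b c d) :
    HermBlock q (f a) (f b) (f c) (f d) := by
  obtain ⟨h1, h2, h3, h4⟩ := H
  constructor
  · simpa using congrArg f h1
  · simpa using congrArg f h2
  · simpa using congrArg f h3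
  · simpa using congrArg f h4

theorem of_map {K : Type*} [Field K] (f : F →+* K)
    (H : HermBlock q (f a) (f b) (f c) (f d)) : HermBlock q a b c d := by
  obtain ⟨h1, h2, h3, h4⟩ := H
  constructor <;> apply f.injective <;> simpa

end HermBlock

/-- The elements of a field fixed by the `q`-power map. -/
abbrev PowFixed (q : ℕ) (F : Type*) [Field F] : Type _ := {x : F // x ^ q = x}

/-- Parametrization of the solutions of `HermBlock`, according to whether `a ≠ 0` or `a = 0`. -/
def hermBlockParam (q : ℕ) (F : Type*) [Field F] :
    Fˣ × ((PowFixed q F × PowFixed q F) ⊕ PowFixed q F) → F × F × F × F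
  | (s, .inl (u, w)) => (s, s * u, s * w, (1 + s * u * (s * w) ^ q) / s ^ q)
  | (s, .inr v) => (0, -((s : F) ^ q)⁻¹, s, s * v)

theorem hermBlockParam_injective : Function.Injective (hermBlockParam q F) := by
  rintro ⟨s, ⟨⟨u, hu⟩, ⟨w, hw⟩⟩ | ⟨v, hv⟩⟩ ⟨s', ⟨⟨u', hu'⟩, ⟨w', hw'⟩⟩ | ⟨v', hv'⟩⟩ h
  · simp only [hermBlockParam, Prod.mk.injEq] at h
    obtain ⟨h1, h2, h3, -⟩ := h
    obtain rfl := Units.ext h1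
    simp only [mul_eq_mul_left_iff, Units.ne_zero, or_false] at h2 h3
    subst h2 h3
    rfl
  · simp [hermBlockParam] at h
  · simp [hermBlockParam] at h
    exact absurd h.1.symm s'.ne_zero
  · simp only [hermBlockParam, Prod.mk.injEq] at h
    obtain ⟨-, -, h3, h4⟩ := h
    obtain rfl := Units.ext h3
    simp only [mul_eq_mul_left_iff, Units.ne_zero, or_false] at h4
    subst h4
    rfl

theorem range_hermBlockParam (hq : q ≠ 0) (hadd : ∀ x y : F, (x + y) ^ q = x ^ q + y ^ q)
    (hneg : (-1 : F) ^ q = -1) (hinv : ∀ x : F, (x ^ q) ^ q = x) :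
    Set.range (hermBlockParam q F) = {x | HermBlock q x.1 x.2.1 x.2.2.1 x.2.2.2} := by
  ext ⟨a, b, c, d⟩
  constructor
  · rintro ⟨⟨s, ⟨⟨u, hu⟩, ⟨w, hw⟩⟩ | ⟨v, hv⟩⟩, h⟩
    · simp only [hermBlockParam, Prod.mk.injEq] at h
      obtain ⟨rfl, rfl, rfl, rfl⟩ := h
      have hs := s.ne_zero
      have hsq : (s : F) ^ q ≠ 0 := pow_ne_zero _ hs
      constructor <;> simp only [div_pow, hadd, mul_pow, hinv, one_pow, hu, hw] <;> field_simp <;>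
        ring
    · simp only [hermBlockParam, Prod.mk.injEq] at h
      obtain ⟨rfl, rfl, rfl, rfl⟩ := h
      have hs := s.ne_zero
      have hsq : (s : F) ^ q ≠ 0 := pow_ne_zero _ hs
      have hb : (-((s : F) ^ q)⁻¹) ^ q = -(s : F)⁻¹ := by
        rw [neg_eq_neg_one_mul, mul_pow, hneg, inv_pow, hinv, neg_one_mul]
      constructor <;> simp only [hb, mul_pow, zero_pow hq, hv] <;> field_simp <;> ring
  · rintro ⟨h1, h2, h3, h4⟩
    simp only at h1 h2 h3 h4
    by_cases ha : a = 0
    · subst ha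
      simp only [zero_pow hq, zero_mul, sub_zero, zero_sub] at h3 h4
      have hc : c ≠ 0 := by rintro rfl; simp at h4
      have hcq : c ^ q ≠ 0 := pow_ne_zero _ hc
      refine ⟨(Units.mk0 c hc, .inr ⟨d / c, ?_⟩), ?_⟩
      · rw [div_pow, div_eq_div_iff hcq hc]
        linear_combination (-(c * c ^ q)) * h2 + c * d ^ q * h3 + d * c ^ q * h4
      · simp only [hermBlockParam, Units.val_mk0, Prod.mk.injEq, true_and]
        refine ⟨?_, mul_div_cancel₀ d hc⟩
        rw [neg_eq_iff_eq_neg, inv_eq_iff_eq_inv, eq_comm, inv_eq_iff_eq_inv]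
        refine eq_inv_of_mul_eq_one_left ?_
        linear_combination -h3
    · have haq : a ^ q ≠ 0 := pow_ne_zero _ ha
      refine ⟨(Units.mk0 a ha, .inl (⟨b / a, ?_⟩, ⟨c / a, ?_⟩)), ?_⟩
      · rw [div_pow, div_eq_div_iff haq ha]
        linear_combination (-(a * a ^ q)) * h2 + b ^ q * a * h3 + b * a ^ q * h4 - b * b ^ q * h1
      · rw [div_pow, div_eq_div_iff haq ha]
        linear_combination h1
      · simp only [hermBlockParam, Units.val_mk0, Prod.mk.injEq, true_and]
        refine ⟨mul_div_cancel₀ b ha, mul_div_cancel₀ c ha, ?_⟩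
        rw [mul_div_cancel₀ b ha, mul_div_cancel₀ c ha, div_eq_iff haq]
        linear_combination h3

theorem card_powFixed [Fintype F] (hF : Fintype.card F = q ^ 2) (hq : 1 < q) :
    Nat.card (PowFixed q F) = q := by
  have hset : {x : F | x ^ q = x} =
      insert 0 (Units.val '' ((powMonoidHom (q - 1) : Fˣ →* Fˣ).ker : Set Fˣ)) := by
    ext x
    have hpow : x ^ q = x ^ (q - 1) * x := (pow_sub_one_mul (by omega) x).symm
    simp only [Set.mem_ofPred_eq, Set.mem_insert_iff, Set.mem_image, SetLike.mem_coe,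
      MonoidHom.mem_ker, powMonoidHom_apply]
    constructor
    · intro hx
      by_cases h0 : x = 0
      · exact .inl h0
      · refine .inr ⟨Units.mk0 x h0, Units.ext ?_, rfl⟩
        rw [hpow] at hx
        simpa [h0] using hx
    · rintro (rfl | ⟨u, hu, rfl⟩)
      · exact zero_pow (by omega)
      · rw [hpow, ← Units.val_pow_eq_pow_val, hu, Units.val_one, one_mul]
  have hunits : Nat.card Fˣ = (q - 1) * (q + 1) := by
    rw [Nat.card_units, Nat.card_eq_fintype_card, hF, mul_comm, ← Nat.sq_sub_sq, one_pow]
  have hker : Nat.card (powMonoidHom (q - 1) : Fˣ →* Fˣ).ker = q - 1 := by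
    rw [IsCyclic.card_powMonoidHom_ker, hunits]
    exact Nat.gcd_eq_right (dvd_mul_right _ _)
  change Nat.card {x : F | x ^ q = x} = q
  rw [Nat.card_coe_set_eq, hset, Set.ncard_insert_of_notMem (by simp) (Set.toFinite _),
    Set.ncard_image_of_injective _ Units.val_injective, ← Nat.card_coe_set_eq,
    SetLike.coe_sort_coe, hker]
  omega

theorem ncard_hermBlock [Fintype F] (hF : Fintype.card F = q ^ 2) (hq : 1 < q)
    (hadd : ∀ x y : F, (x + y) ^ q = x ^ q + y ^ q) (hneg : (-1 : F) ^ q = -1) :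
    {x : F × F × F × F | HermBlock q x.1 x.2.1 x.2.2.1 x.2.2.2}.ncard
      = q * (q - 1) * (q + 1) ^ 2 := by
  have hinv : ∀ x : F, (x ^ q) ^ q = x := fun x ↦ by
    rw [← pow_mul, ← sq, ← hF, FiniteField.pow_card]
  rw [← range_hermBlockParam (by omega) hadd hneg hinv,
    Set.ncard_range_of_injective hermBlockParam_injective, Nat.card_prod,
    Nat.card_sum, Nat.card_prod, card_powFixed hF hq, Nat.card_units, Nat.card_eq_fintype_card,
    hF]
  have : q ^ 2 - 1 = (q + 1) * (q - 1) := by rw [← Nat.sq_sub_sq, one_pow]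
  rw [this]
  ring

/-- A linear map fixing `(0 : 0 : 1)` and preserving the zero set of the Hermitian polynomial over
an algebraically closed field is unitary and fixes the polar line `Z = 0`. -/
theorem hermBlock_of_preserves [IsAlgClosed F] (hodd : Odd q) (h2 : (2 : F) ≠ 0)
    (hadd : ∀ x y : F, (x + y) ^ q = x ^ q + y ^ q)
    {ω : F} (hω0 : ω ≠ 0) (hω : ω ^ q = -ω) {a b c d e f : F}
    (H : ∀ x y z : F, (x ≠ 0 ∨ y ≠ 0) → (x * y ^ q - y * x ^ q + ω * z ^ (q + 1) = 0 ↔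
      (a * x + b * y) * (c * x + d * y) ^ q - (c * x + d * y) * (a * x + b * y) ^ q
        + ω * (e * x + f * y + z) ^ (q + 1) = 0)) :
    e = 0 ∧ f = 0 ∧ HermBlock q a b c d := by
  have hq0 : q ≠ 0 := hodd.pos.ne'
  have hroot : ∀ A : F, ∃ s : F, A + ω * s ^ (q + 1) = 0 := fun A ↦ by
    obtain ⟨s, hs⟩ := IsAlgClosed.exists_pow_nat_eq (-A / ω) q.succ_pos
    exact ⟨s, by rw [hs]; field_simp; ring⟩
  have hiso : ∀ x y : F, (x ≠ 0 ∨ y ≠ 0) → x * y ^ q - y * x ^ q = 0 → e * x + f * y = 0 := by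
    intro x y hxy hA
    obtain ⟨s, hs⟩ :=
      hroot ((a * x + b * y) * (c * x + d * y) ^ q - (c * x + d * y) * (a * x + b * y) ^ q)
    have key : ∀ r : F, r ^ (q + 1) = s ^ (q + 1) → r = e * x + f * y := by
      intro r hr
      have := (H x y (r - (e * x + f * y)) hxy).2 (by rw [add_sub_cancel, hr, hs])
      rw [hA, zero_add] at this
      exact sub_eq_zero.1 (eq_zero_of_pow_eq_zero ((mul_eq_zero.1 this).resolve_left hω0))
    have k1 := key s rfl
    have k2 := key (-s) (hodd.add_one.neg_pow s)
    refine (mul_eq_zero.1 (?_ : 2 * (e * x + f * y) = 0)).resolve_left h2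
    linear_combination -k1 - k2
  have he : e = 0 := by simpa [hq0] using hiso 1 0 (by simp) (by simp [hq0])
  have hf : f = 0 := by simpa [hq0] using hiso 0 1 (by simp) (by simp [hq0])
  subst he hf
  have hform : ∀ x y : F, (x ≠ 0 ∨ y ≠ 0) →
      (a * x + b * y) * (c * x + d * y) ^ q - (c * x + d * y) * (a * x + b * y) ^ q
        = x * y ^ q - y * x ^ q := by
    intro x y hxy
    obtain ⟨s, hs⟩ := hroot (x * y ^ q - y * x ^ q)
    have := (H x y s hxy).1 hs
    rw [zero_mul, zero_mul, zero_add, zero_add] at this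
    linear_combination this - hs
  have h10 : a * c ^ q - c * a ^ q = 0 := by simpa [hq0] using hform 1 0 (by simp)
  have h01 : b * d ^ q - d * b ^ q = 0 := by simpa [hq0] using hform 0 1 (by simp)
  have h11 := hform 1 1 (by simp)
  have hω1 := hform ω 1 (by simp)
  simp only [hadd, mul_pow, one_pow, mul_one, hω] at h11 hω1
  have hcross : a * d ^ q - b ^ q * c = 1 := by
    refine sub_eq_zero.1 ((mul_eq_zero.1 (?_ : 2 * ω * (a * d ^ q - b ^ q * c - 1) = 0)).resolve_left
      (mul_ne_zero h2 hω0))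
    linear_combination hω1 + ω * h11 + (ω ^ 2 - ω) * h10 - (ω + 1) * h01
  refine ⟨rfl, rfl, ?_, ?_, ?_, hcross⟩
  · linear_combination h10
  · linear_combination h01
  · linear_combination h11 - h10 - h01 - hcross

end Frobenius

section Projective

variable {F : Type*} [Field F]

theorem Matrix.GeneralLinearGroup.mk_eq_mk_iff {n : Type*} [Fintype n] [DecidableEq n] [Nonempty n]
    {g g' : GeneralLinearGroup n F} :
    (QuotientGroup.mk g : GeneralLinearGroup n F ⧸ Subgroup.center (GeneralLinearGroup n F))
      = QuotientGroup.mk g' ↔ ∃ z : F, z ≠ 0 ∧ (g' : Matrix n n F) = z • (g : Matrix n n F) := by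
  rw [QuotientGroup.eq, GeneralLinearGroup.mem_center_iff_val_mem_range_scalar]
  constructor
  · rintro ⟨z, hz⟩
    have hg : (g' : Matrix n n F) = z • (g : Matrix n n F) := by
      have : g' = g * (g⁻¹ * g') := by group
      rw [this, Units.val_mul, ← hz, Matrix.scalar_apply, ← Matrix.smul_one_eq_diagonal,
        Matrix.mul_smul, mul_one]
    refine ⟨z, ?_, hg⟩
    rintro rfl
    rw [zero_smul] at hg
    exact g'.ne_zero hg
  · rintro ⟨z, -, hz⟩
    refine ⟨z, ?_⟩
    rw [Units.val_mul, hz, Matrix.mul_smul, ← Units.val_mul, inv_mul_cancel, Units.val_one,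
      Matrix.scalar_apply, Matrix.smul_one_eq_diagonal]

/-- The matrices fixing the point `(0 : 0 : 1)`. -/
theorem mulVec_eq_smul_iff (M : Matrix (Fin 3) (Fin 3) F) :
    (∃ c : F, M.mulVec ![0, 0, 1] = c • ![0, 0, 1]) ↔ M 0 2 = 0 ∧ M 1 2 = 0 := by
  constructor
  · rintro ⟨c, hc⟩
    have h0 := congrFun hc 0
    have h1 := congrFun hc 1
    simp [Matrix.mulVec, dotProduct, Fin.sum_univ_three] at h0 h1
    exact ⟨h0, h1⟩
  · rintro ⟨h0, h1⟩
    refine ⟨M 2 2, ?_⟩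
    ext i
    fin_cases i <;> simp [Matrix.mulVec, dotProduct, Fin.sum_univ_three, h0, h1]

/-- An invertible matrix commuting up to a scalar with `diag(-1, -1, 1)` fixes `(0 : 0 : 1)`. -/
theorem apply_eq_zero_of_mul_diag (h2 : (2 : F) ≠ 0) {M : Matrix (Fin 3) (Fin 3) F}
    (hM : M.det ≠ 0) {z : F}
    (h : !![-1, 0, 0; 0, -1, 0; 0, 0, 1] * M = z • (M * !![-1, 0, 0; 0, -1, 0; 0, 0, 1])) :
    M 0 2 = 0 ∧ M 1 2 = 0 := by
  have e := fun i j ↦ congrFun (congrFun h i) j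
  simp only [Matrix.mul_apply, Matrix.smul_apply, Fin.sum_univ_three, smul_eq_mul] at e
  have e00 := e 0 0
  have e01 := e 0 1
  have e02 := e 0 2
  have e10 := e 1 0
  have e11 := e 1 1
  have e12 := e 1 2
  have e22 := e 2 2
  simp at e00 e01 e02 e10 e11 e12 e22
  have hz : z ≠ -1 := by
    rintro rfl
    have cancel : ∀ x : F, 2 * x = 0 → x = 0 := fun x hx ↦ (mul_eq_zero.1 hx).resolve_left h2
    have z00 := cancel (M 0 0) (by linear_combination e00)
    have z01 := cancel (M 0 1) (by linear_combination e01)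
    have z10 := cancel (M 1 0) (by linear_combination e10)
    have z11 := cancel (M 1 1) (by linear_combination e11)
    have z22 := cancel (M 2 2) (by linear_combination e22)
    apply hM
    rw [Matrix.det_fin_three, z00, z01, z10, z11, z22]
    ring
  have hz' : z + 1 ≠ 0 := fun h0 ↦ hz (eq_neg_of_add_eq_zero_left h0)
  constructor
  · refine (mul_eq_zero.1 (?_ : (z + 1) * M 0 2 = 0)).resolve_left hz'
    linear_combination -e02
  · refine (mul_eq_zero.1 (?_ : (z + 1) * M 1 2 = 0)).resolve_left hz'
    linear_combination -e12

end Projective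

theorem mul_comm_iff_conj_mem_zpowers {G : Type*} [Group G] {τ : G} (hτ : τ ≠ 1)
    (hsq : τ * τ = 1) (g : G) : g * τ = τ * g ↔ g * τ * g⁻¹ ∈ Subgroup.zpowers τ := by
  constructor
  · intro h
    rw [h, mul_inv_cancel_right]
    exact Subgroup.mem_zpowers τ
  · rintro ⟨n, hn⟩
    have hn : τ ^ n = g * τ * g⁻¹ := hn
    rcases Int.even_or_odd' n with ⟨k, rfl | rfl⟩
    · rw [_root_.zpow_mul, zpow_two, hsq, _root_.one_zpow, eq_comm, conj_eq_one_iff] at hn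
      exact absurd hn hτ
    · rw [_root_.zpow_add, _root_.zpow_mul, zpow_two, hsq, _root_.one_zpow, one_mul, zpow_one] at hn
      nth_rewrite 2 [hn]
      group

section Preserves

variable {q : ℕ} {F K : Type} [Field F] [Field K] [Algebra F K]

/-- The linear map defined by `M` preserves the projective curve over `K` on which the Hermitian
polynomial vanishes. -/
def PreservesHerm (q : ℕ) (K : Type) {F : Type} [Field F] [Field K] [Algebra F K] (ω : F)
    (M : Matrix (Fin 3) (Fin 3) F) : Prop :=
  ∀ v : Fin 3 → K, v ≠ 0 → (hermEval q (algebraMap F K ω) v = 0 ↔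
    hermEval q (algebraMap F K ω) ((M.map (algebraMap F K)).mulVec v) = 0)

theorem hermEval_smul (ω z : K) (v : Fin 3 → K) :
    hermEval q ω (z • v) = z ^ (q + 1) * hermEval q ω v := by
  simp only [hermEval, Pi.smul_apply, smul_eq_mul, mul_pow]
  ring

theorem PreservesHerm.smul {ω z : F} (hz : z ≠ 0) {M : Matrix (Fin 3) (Fin 3) F}
    (hM : PreservesHerm q K ω M) : PreservesHerm q K ω (z • M) := by
  intro v hv
  have hmap : (z • M).map (algebraMap F K) = algebraMap F K z • M.map (algebraMap F K) := by
    ext i j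
    simp
  have hz' : algebraMap F K z ^ (q + 1) ≠ 0 := pow_ne_zero _ (by simpa using hz)
  rw [hM v hv, hmap, Matrix.smul_mulVec, hermEval_smul, mul_eq_zero, or_iff_right hz']

theorem HermBlock.preservesHerm (hadd : ∀ x y : K, (x + y) ^ q = x ^ q + y ^ q) {ω a b c d : F}
    (H : HermBlock q a b c d) :
    PreservesHerm q K ω !![a, b, 0; c, d, 0; 0, 0, 1] := by
  intro v _
  have := (H.map (algebraMap F K)).form_eq hadd (v 0) (v 1)
  simp [hermEval, Matrix.mulVec, dotProduct, Fin.sum_univ_three, this]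

theorem PreservesHerm.exists_hermBlock [IsAlgClosed K] (hodd : Odd q) (h2 : (2 : K) ≠ 0)
    (hadd : ∀ x y : K, (x + y) ^ q = x ^ q + y ^ q)
    {ω : F} (hω0 : ω ≠ 0) (hω : ω ^ q = -ω) {M : Matrix (Fin 3) (Fin 3) F}
    (hM : PreservesHerm q K ω M) (h02 : M 0 2 = 0) (h12 : M 1 2 = 0) (h22 : M 2 2 = 1) :
    ∃ a b c d : F, M = !![a, b, 0; c, d, 0; 0, 0, 1] ∧ HermBlock q a b c d := by
  obtain ⟨he, hf, H⟩ := hermBlock_of_preserves (ω := algebraMap F K ω)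
    (a := algebraMap F K (M 0 0)) (b := algebraMap F K (M 0 1))
    (c := algebraMap F K (M 1 0)) (d := algebraMap F K (M 1 1))
    (e := algebraMap F K (M 2 0)) (f := algebraMap F K (M 2 1)) hodd h2 hadd (by simpa using hω0)
    (by rw [← map_pow, hω, map_neg]) (by
      intro x y z hxy
      have hv : ![x, y, z] ≠ 0 := by
        intro h0
        have e0 := congrFun h0 0
        have e1 := congrFun h0 1
        simp at e0 e1
        exact hxy.elim (· e0) (· e1)
      simpa [hermEval, Matrix.mulVec, dotProduct, Fin.sum_univ_three, h02, h12, h22]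
        using hM _ hv)
  refine ⟨M 0 0, M 0 1, M 1 0, M 1 1, ?_, H.of_map _⟩
  simp only [map_eq_zero] at he hf
  ext i j
  fin_cases i <;> fin_cases j <;> simp [he, hf, h02, h12, h22]

end Preserves

/-- Let `q` be a power of an odd prime and `τ ∈ PGU(3,q)` the involution
induced by `diag(-1,-1,1)`.  The stabilizer of `P₀ = (0:0:1)` in `PGU(3,q)` equals the
centralizer `C_{PGU(3,q)}(τ)`, which equals the normalizer `N_{PGU(3,q)}(⟨τ⟩)`; this
stabilizer is the image in `PGL(3,𝔽_{q²})` of the matrix group `𝓜` and has order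
`q(q-1)(q+1)²`. -/
theorem stmt_4 (p : ℕ) (hp : p.Prime) (hodd : p ≠ 2) (h : ℕ) (hh : 1 ≤ h)
    (q : ℕ) (hq : q = p ^ h)
    (F : Type) [Field F] [Fintype F] (hF : Fintype.card F = q ^ 2)
    (K : Type) [Field K] [IsAlgClosed K] [Algebra F K]
    (ω : F) (hω : ω ^ (q - 1) = -1)
    (PGU : Subgroup (Matrix.GeneralLinearGroup (Fin 3) F ⧸
      Subgroup.center (Matrix.GeneralLinearGroup (Fin 3) F)))
    (hPGU : ∀ gbar, gbar ∈ PGU ↔ ∃ g : Matrix.GeneralLinearGroup (Fin 3) F,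
      gbar = QuotientGroup.mk g ∧ ∀ v : Fin 3 → K, v ≠ 0 →
        (hermEval q (algebraMap F K ω) v = 0 ↔
          hermEval q (algebraMap F K ω)
            (((g : Matrix (Fin 3) (Fin 3) F).map (algebraMap F K)).mulVec v) = 0))
    (Mset : Set (Matrix (Fin 3) (Fin 3) F))
    (hMset : ∀ M, M ∈ Mset ↔ ∃ a b c d : F,
      M = !![a, b, 0; c, d, 0; 0, 0, 1] ∧
      a * c ^ q - a ^ q * c = 0 ∧ b * d ^ q - b ^ q * d = 0 ∧
      b * c ^ q - a ^ q * d = -1 ∧ a * d ^ q - b ^ q * c = 1)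
    (t : Matrix.GeneralLinearGroup (Fin 3) F)
    (ht : (t : Matrix (Fin 3) (Fin 3) F) = !![-1, 0, 0; 0, -1, 0; 0, 0, 1]) :
    letI τ : Matrix.GeneralLinearGroup (Fin 3) F ⧸
      Subgroup.center (Matrix.GeneralLinearGroup (Fin 3) F) := QuotientGroup.mk t
    -- the stabilizer of `P₀` in `PGU(3,q)` equals the centralizer of `τ` in `PGU(3,q)` ...
    ({gbar | gbar ∈ PGU ∧ ∃ g : Matrix.GeneralLinearGroup (Fin 3) F,
        gbar = QuotientGroup.mk g ∧
        ∃ c : F, (g : Matrix (Fin 3) (Fin 3) F).mulVec ![0, 0, 1] = c • ![0, 0, 1]}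
      = {gbar | gbar ∈ PGU ∧ gbar * τ = τ * gbar}) ∧
    -- ... which equals the normalizer of `⟨τ⟩` in `PGU(3,q)` ...
    ({gbar | gbar ∈ PGU ∧ gbar * τ = τ * gbar}
      = {gbar | gbar ∈ PGU ∧ gbar * τ * gbar⁻¹ ∈ Subgroup.zpowers τ}) ∧
    -- ... and is the image in `PGL(3,𝔽_{q²})` of the matrix group `𝓜` ...
    ({gbar | gbar ∈ PGU ∧ ∃ g : Matrix.GeneralLinearGroup (Fin 3) F,
        gbar = QuotientGroup.mk g ∧
        ∃ c : F, (g : Matrix (Fin 3) (Fin 3) F).mulVec ![0, 0, 1] = c • ![0, 0, 1]}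
      = {gbar | ∃ g : Matrix.GeneralLinearGroup (Fin 3) F,
          gbar = QuotientGroup.mk g ∧ (g : Matrix (Fin 3) (Fin 3) F) ∈ Mset}) ∧
    -- ... and has order `q(q-1)(q+1)²`
    Set.ncard {gbar | gbar ∈ PGU ∧ ∃ g : Matrix.GeneralLinearGroup (Fin 3) F,
        gbar = QuotientGroup.mk g ∧
        ∃ c : F, (g : Matrix (Fin 3) (Fin 3) F).mulVec ![0, 0, 1] = c • ![0, 0, 1]}
      = q * (q - 1) * (q + 1) ^ 2 := by
  set τ : Matrix.GeneralLinearGroup (Fin 3) F ⧸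
    Subgroup.center (Matrix.GeneralLinearGroup (Fin 3) F) := QuotientGroup.mk t
  have hFp : Fact p.Prime := ⟨hp⟩
  have hpodd : Odd p := hp.odd_of_ne_two hodd
  have hqodd : Odd q := hq ▸ hpodd.pow
  have hq1 : 1 < q := hq ▸ Nat.one_lt_pow (by omega) hp.one_lt
  have hcharF : CharP F p := charP_of_card_eq_prime_pow (f := h * 2) (by rw [hF, hq, pow_mul])
  have hcharK : CharP K p := charP_of_injective_algebraMap (algebraMap F K).injective p
  have haddF : ∀ x y : F, (x + y) ^ q = x ^ q + y ^ q := fun x y ↦ by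
    rw [hq, add_pow_char_pow]
  have haddK : ∀ x y : K, (x + y) ^ q = x ^ q + y ^ q := fun x y ↦ by
    rw [hq, add_pow_char_pow]
  have h2F : (2 : F) ≠ 0 := Ring.two_ne_zero (by rwa [ringChar.eq F p])
  have h2K : (2 : K) ≠ 0 := Ring.two_ne_zero (by rwa [ringChar.eq K p])
  have hω0 : ω ≠ 0 := by
    rintro rfl
    rw [zero_pow (by omega)] at hω
    exact neg_ne_zero.2 one_ne_zero hω.symm
  have hωq : ω ^ q = -ω := by
    rw [← pow_sub_one_mul (by omega : q ≠ 0), hω, neg_one_mul]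
  have hM : ∀ M, M ∈ Mset ↔ ∃ a b c d : F, M = !![a, b, 0; c, d, 0; 0, 0, 1] ∧
      HermBlock q a b c d := by
    intro M
    rw [hMset]
    constructor
    · rintro ⟨a, b, c, d, hM, h1, h2, h3, h4⟩
      exact ⟨a, b, c, d, hM, h1, h2, h3, h4⟩
    · rintro ⟨a, b, c, d, hM, h1, h2, h3, h4⟩
      exact ⟨a, b, c, d, hM, h1, h2, h3, h4⟩
  have hstab : {gbar | gbar ∈ PGU ∧ ∃ g : Matrix.GeneralLinearGroup (Fin 3) F,
        gbar = QuotientGroup.mk g ∧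
        ∃ c : F, (g : Matrix (Fin 3) (Fin 3) F).mulVec ![0, 0, 1] = c • ![0, 0, 1]}
      = {gbar | ∃ g : Matrix.GeneralLinearGroup (Fin 3) F,
          gbar = QuotientGroup.mk g ∧ (g : Matrix (Fin 3) (Fin 3) F) ∈ Mset} := by
    ext gbar
    simp only [Set.mem_ofPred_eq, mulVec_eq_smul_iff]
    constructor
    · rintro ⟨hg, g, rfl, h02, h12⟩
      obtain ⟨g₁, hg₁, hpres⟩ := (hPGU _).1 hg
      obtain ⟨z, -, hz⟩ := Matrix.GeneralLinearGroup.mk_eq_mk_iff.1 hg₁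
      have h02' : (g₁ : Matrix (Fin 3) (Fin 3) F) 0 2 = 0 := by simp [hz, h02]
      have h12' : (g₁ : Matrix (Fin 3) (Fin 3) F) 1 2 = 0 := by simp [hz, h12]
      have hdet : (g₁ : Matrix (Fin 3) (Fin 3) F).det ≠ 0 := g₁.det_ne_zero
      have h22 : (g₁ : Matrix (Fin 3) (Fin 3) F) 2 2 ≠ 0 := by
        intro h22
        apply hdet
        rw [Matrix.det_fin_three, h02', h12', h22]
        ring
      have hk := inv_ne_zero h22
      set k := ((g₁ : Matrix (Fin 3) (Fin 3) F) 2 2)⁻¹ with hkdef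
      refine ⟨Matrix.GeneralLinearGroup.mkOfDetNeZero (k • (g₁ : Matrix (Fin 3) (Fin 3) F))
        (by rw [Matrix.det_smul]; exact mul_ne_zero (pow_ne_zero _ hk) hdet), ?_, ?_⟩
      · rw [hg₁]
        exact Matrix.GeneralLinearGroup.mk_eq_mk_iff.2 ⟨k, hk, rfl⟩
      · exact (hM _).2 ((PreservesHerm.smul hk hpres).exists_hermBlock hqodd h2K haddK hω0 hωq
          (by simp [h02']) (by simp [h12']) (by simp [hkdef, h22]))
    · rintro ⟨g, rfl, hg⟩
      obtain ⟨a, b, c, d, hg, H⟩ := (hM _).1 hg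
      refine ⟨(hPGU _).2 ⟨g, rfl, ?_⟩, g, rfl, ?_⟩
      · rw [hg]
        exact H.preservesHerm haddK
      · simp [hg]
  have hτ : τ ≠ 1 := by
    intro h1
    obtain ⟨z, -, hz⟩ := Matrix.GeneralLinearGroup.mk_eq_mk_iff.1 (h1.symm : _ = QuotientGroup.mk t)
    rw [ht] at hz
    have e0 := congrFun (congrFun hz 0) 0
    have e2 := congrFun (congrFun hz 2) 2
    simp at e0 e2
    apply h2F
    linear_combination e2 - e0
  have hsq : τ * τ = 1 := by
    have : t * t = 1 := by
      ext i j
      rw [Units.val_mul, ht]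
      fin_cases i <;> fin_cases j <;> simp [Matrix.mul_apply, Fin.sum_univ_three]
    change (QuotientGroup.mk (t * t) : _ ⧸ _) = _
    rw [this]
    rfl
  refine ⟨?_, ?_, hstab, ?_⟩
  · apply Set.Subset.antisymm
    · intro gbar hg
      refine ⟨hg.1, ?_⟩
      rw [hstab] at hg
      obtain ⟨g, rfl, hg⟩ := hg
      obtain ⟨a, b, c, d, hg, -⟩ := (hM _).1 hg
      have : g * t = t * g := by
        ext i j
        rw [Units.val_mul, Units.val_mul, ht, hg]
        fin_cases i <;> fin_cases j <;> simp [Matrix.mul_apply, Fin.sum_univ_three]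
      exact congrArg QuotientGroup.mk this
    · rintro gbar ⟨hg, hcomm⟩
      refine ⟨hg, ?_⟩
      obtain ⟨g, rfl⟩ := QuotientGroup.mk_surjective gbar
      refine ⟨g, rfl, (mulVec_eq_smul_iff _).2 ?_⟩
      obtain ⟨z, -, hz⟩ := Matrix.GeneralLinearGroup.mk_eq_mk_iff.1
        (hcomm : (QuotientGroup.mk (g * t) : _ ⧸ _) = QuotientGroup.mk (t * g))
      rw [Units.val_mul, Units.val_mul, ht] at hz
      exact apply_eq_zero_of_mul_diag h2F g.det_ne_zero hz
  · simp only [mul_comm_iff_conj_mem_zpowers hτ hsq]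
  · rw [hstab, ← ncard_hermBlock hF hq1 haddF hqodd.neg_one_pow]
    have hdet : ∀ x : F × F × F × F, HermBlock q x.1 x.2.1 x.2.2.1 x.2.2.2 →
        Matrix.det !![x.1, x.2.1, 0; x.2.2.1, x.2.2.2, 0; 0, 0, 1] ≠ 0 := by
      intro x H
      simpa [Matrix.det_fin_three] using H.det_ne_zero
    symm
    refine Set.ncard_congr
      (fun x hx ↦ QuotientGroup.mk (Matrix.GeneralLinearGroup.mkOfDetNeZero _ (hdet x hx))) ?_ ?_ ?_
    · intro x hx
      exact ⟨_, rfl, (hM _).2 ⟨_, _, _, _, rfl, hx⟩⟩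
    · rintro ⟨a, b, c, d⟩ ⟨a', b', c', d'⟩ hx hx' heq
      obtain ⟨z, -, hz⟩ := Matrix.GeneralLinearGroup.mk_eq_mk_iff.1 heq
      have e := fun i j ↦ congrFun (congrFun hz i) j
      have e22 := e 2 2
      have e00 := e 0 0
      have e01 := e 0 1
      have e10 := e 1 0
      have e11 := e 1 1
      simp [Matrix.GeneralLinearGroup.mkOfDetNeZero] at e00 e01 e10 e11 e22
      simp [e00, e01, e10, e11, ← e22]
    · rintro _ ⟨g, rfl, hg⟩
      obtain ⟨a, b, c, d, hg, H⟩ := (hM _).1 hg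
      exact ⟨(a, b, c, d), H, congrArg QuotientGroup.mk (Units.ext hg.symm)⟩
end

section
/- Let q be a prime power and let P, Q be two distinct 𝔽_{q²}-rational points of the Hermitian curve 𝓗_q. Then the subgroup of PGU(3,q) fixing both P and Q has order q² − 1, and exactly q of its q² − 2 nontrivial elements are homologies with axis the line PQ. -/
open Matrix

/-- The Fermat (Hermitian) polynomial `X^(q+1) + Y^(q+1) + Z^(q+1)` evaluated at a vector. -/
def fermatEval (q : ℕ) {K : Type} [Field K] (v : Fin 3 → K) : K :=
  v 0 ^ (q + 1) + v 1 ^ (q + 1) + v 2 ^ (q + 1)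

/-- `g` fixes (as a set) every line through the point `P`. -/
def FixesLinesThrough {F : Type} [Field F] (g : Matrix (Fin 3) (Fin 3) F)
    (P : Fin 3 → F) : Prop :=
  ∀ u : Fin 3 → F, g.mulVec u ∈ Submodule.span F {P, u}

/-- A nontrivial projectivity is a homology with axis the line `PQ` if it fixes the line
`PQ` pointwise and has a center (a point all lines through which are fixed) off `PQ`. -/
def IsHomologyWithAxis {F : Type} [Field F]
    (gbar : Matrix.GeneralLinearGroup (Fin 3) F ⧸
      Subgroup.center (Matrix.GeneralLinearGroup (Fin 3) F))
    (P Q : Fin 3 → F) : Prop :=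
  gbar ≠ 1 ∧ ∃ g : Matrix.GeneralLinearGroup (Fin 3) F, gbar = QuotientGroup.mk g ∧
    (∀ v ∈ Submodule.span F {P, Q},
      ∃ c : F, (g : Matrix (Fin 3) (Fin 3) F).mulVec v = c • v) ∧
    ∃ C : Fin 3 → F, C ∉ Submodule.span F {P, Q} ∧
      FixesLinesThrough (g : Matrix (Fin 3) (Fin 3) F) C

section Hermitian

variable {F : Type*} [Field F]

/-- The sesquilinear form `∑ φ(vᵢ) wᵢ`. -/
def sesqForm (φ : F →+* F) (v w : Fin 3 → F) : F :=
  φ (v 0) * w 0 + φ (v 1) * w 1 + φ (v 2) * w 2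

/-- The pole of the line `PQ` with respect to `sesqForm φ`. -/
def linePole (φ : F →+* F) (P Q : Fin 3 → F) : Fin 3 → F :=
  ![φ (P 1 * Q 2 - P 2 * Q 1), φ (P 2 * Q 0 - P 0 * Q 2), φ (P 0 * Q 1 - P 1 * Q 0)]

/-- The matrix with columns `P`, `Q`, `R`. -/
def frameMatrix (P Q R : Fin 3 → F) : Matrix (Fin 3) (Fin 3) F :=
  !![P 0, Q 0, R 0; P 1, Q 1, R 1; P 2, Q 2, R 2]

lemma frameMatrix_mulVec (P Q R c : Fin 3 → F) :
    frameMatrix P Q R *ᵥ c = c 0 • P + c 1 • Q + c 2 • R := by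
  ext i
  fin_cases i <;> simp [frameMatrix, Matrix.mulVec, dotProduct, Fin.sum_univ_three] <;> ring

lemma sesqForm_frameMatrix_mulVec (φ : F →+* F) {P Q R : Fin 3 → F} (x y z : F)
    (hPP : sesqForm φ P P = 0) (hQQ : sesqForm φ Q Q = 0) (hPR : sesqForm φ P R = 0)
    (hRP : sesqForm φ R P = 0) (hQR : sesqForm φ Q R = 0) (hRQ : sesqForm φ R Q = 0) :
    sesqForm φ (frameMatrix P Q R *ᵥ ![x, y, z]) (frameMatrix P Q R *ᵥ ![x, y, z]) =
      φ x * y * sesqForm φ P Q + φ y * x * sesqForm φ Q P + φ z * z * sesqForm φ R R := by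
  rw [frameMatrix_mulVec]
  simp only [sesqForm, Pi.add_apply, Pi.smul_apply, smul_eq_mul, map_add, map_mul,
    Matrix.cons_val_zero, Matrix.cons_val_one, Matrix.cons_val] at *
  linear_combination φ x * x * hPP + φ y * y * hQQ + φ x * z * hPR + φ z * x * hRP
    + φ y * z * hQR + φ z * y * hRQ

variable {φ : F →+* F}

lemma sesqForm_swap (hφ : ∀ x, φ (φ x) = x) (v w : Fin 3 → F) :
    sesqForm φ w v = φ (sesqForm φ v w) := by
  simp only [sesqForm, map_add, map_mul, hφ]
  ring

lemma sesqForm_left_linePole (P Q : Fin 3 → F) : sesqForm φ P (linePole φ P Q) = 0 := by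
  simp [sesqForm, linePole]
  ring

lemma sesqForm_right_linePole (P Q : Fin 3 → F) : sesqForm φ Q (linePole φ P Q) = 0 := by
  simp [sesqForm, linePole]
  ring

lemma sesqForm_linePole_self (hφ : ∀ x, φ (φ x) = x) {P Q : Fin 3 → F} (hP : sesqForm φ P P = 0) :
    sesqForm φ (linePole φ P Q) (linePole φ P Q) = -(sesqForm φ P Q * φ (sesqForm φ P Q)) := by
  simp only [sesqForm, linePole, map_add, map_mul, map_sub, hφ,
    Matrix.cons_val_zero, Matrix.cons_val_one, Matrix.cons_val] at *
  linear_combination (φ (Q 0) * Q 0 + φ (Q 1) * Q 1 + φ (Q 2) * Q 2) * hP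

lemma det_frameMatrix_linePole (hφ : ∀ x, φ (φ x) = x) {P Q : Fin 3 → F} (hP : sesqForm φ P P = 0) :
    (frameMatrix P Q (linePole φ P Q)).det = -(sesqForm φ P Q * φ (sesqForm φ P Q)) := by
  rw [← sesqForm_linePole_self hφ hP, frameMatrix, Matrix.det_fin_three]
  simp [sesqForm, linePole, hφ]
  ring

lemma sesqForm_ne_zero (hφ : ∀ x, φ (φ x) = x) {P Q : Fin 3 → F} (hP0 : P ≠ 0)
    (hP : sesqForm φ P P = 0) (hQ : sesqForm φ Q Q = 0) (hPQ : ∀ c : F, Q ≠ c • P) :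
    sesqForm φ P Q ≠ 0 := by
  intro h
  have h' : sesqForm φ Q P = 0 := by rw [sesqForm_swap hφ, h, map_zero]
  have key : ∀ t : F, φ t * t = 0 → t = 0 := by
    intro t ht
    simpa using ht
  have e : P 1 * Q 2 - P 2 * Q 1 = 0 ∧ P 2 * Q 0 - P 0 * Q 2 = 0 ∧
      P 0 * Q 1 - P 1 * Q 0 = 0 := by
    simp only [sesqForm] at *
    refine ⟨key _ ?_, key _ ?_, key _ ?_⟩ <;> simp only [map_sub, map_mul]
    · linear_combination (φ (Q 1) * Q 1 + φ (Q 2) * Q 2) * hP - φ (P 0) * P 0 * hQ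
        - (φ (Q 1) * P 1 + φ (Q 2) * P 2) * h + φ (P 0) * Q 0 * h'
    · linear_combination (φ (Q 2) * Q 2 + φ (Q 0) * Q 0) * hP - φ (P 1) * P 1 * hQ
        - (φ (Q 2) * P 2 + φ (Q 0) * P 0) * h + φ (P 1) * Q 1 * h'
    · linear_combination (φ (Q 0) * Q 0 + φ (Q 1) * Q 1) * hP - φ (P 2) * P 2 * hQ
        - (φ (Q 0) * P 0 + φ (Q 1) * P 1) * h + φ (P 2) * Q 2 * h'
  obtain ⟨e0, e1, e2⟩ := e
  obtain ⟨i, hi⟩ := Function.ne_iff.mp hP0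
  apply hPQ (Q i / P i)
  simp only [Pi.zero_apply] at hi
  ext j
  simp only [Pi.smul_apply, smul_eq_mul]
  field_simp
  fin_cases i <;> fin_cases j <;>
    simp only [Fin.zero_eta, Fin.mk_one, Fin.reduceFinMk] <;>
    first
      | ring1
      | linear_combination e0
      | linear_combination e1
      | linear_combination e2
      | linear_combination -e0
      | linear_combination -e1
      | linear_combination -e2

end Hermitian

section Trace

variable {F : Type*} [Field F] {φ : F →+* F}

lemma exists_add_conj_eq (hφ : ∀ x, φ (φ x) = x) (hφ1 : ∃ x, φ x ≠ x)
    {t : F} (ht : φ t = t) : ∃ s, s + φ s = t := by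
  obtain ⟨u, hu⟩ : ∃ u, u + φ u ≠ 0 := by
    by_contra! hall
    obtain ⟨x, hx⟩ := hφ1
    have h1 := hall 1
    have h2 := hall x
    rw [map_one] at h1
    exact hx (by linear_combination h2 - x * h1)
  refine ⟨u * (t / (u + φ u)), ?_⟩
  simp only [map_mul, map_div₀, map_add, hφ, ht]
  rw [add_comm (φ u) u]
  field_simp

/-- A scalar `t` carrying the solutions of `s + φ s = m` to solutions of `s + φ s = m'` satisfies
`t * m = m'`. -/
lemma mul_eq_of_add_conj (hφ : ∀ x, φ (φ x) = x) (hφ1 : ∃ x, φ x ≠ x)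
    {t m m' : F} (hm : φ m = m)
    (h : ∀ s, s + φ s = m → t * s + φ (t * s) = m') : t * m = m' := by
  obtain ⟨s, hs⟩ := exists_add_conj_eq hφ hφ1 hm
  obtain ⟨x, hx⟩ := hφ1
  have h1 := h s hs
  have h2 := h (s + (x - φ x)) (by simp only [map_add, map_sub, hφ]; linear_combination hs)
  simp only [map_mul, map_add, map_sub, hφ] at h1 h2
  have h3 : (t - φ t) * (x - φ x) = 0 := by linear_combination h2 - h1
  have h4 : t - φ t = 0 := by
    rcases mul_eq_zero.mp h3 with h4 | h4
    · exact h4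
    · exact absurd (sub_eq_zero.mp h4).symm hx
  linear_combination h1 - t * hs + h4 * φ s

/-- A linear map that fixes the isotropic points `⟨1,0,0⟩` and `⟨0,1,0⟩` and preserves isotropy
for the Hermitian form with Gram matrix `!![0, d, 0; φ d, 0, 0; 0, 0, -d * φ d]` is a diagonal
similitude. -/
lemma diagonal_of_preserves_isotropic (hφ : ∀ x, φ (φ x) = x) (hφ1 : ∃ x, φ x ≠ x)
    {d a b α β γ : F} (hd : d ≠ 0) (ha : a ≠ 0) (hb : b ≠ 0)
    (h : ∀ x y z : F, ![x, y, z] ≠ 0 →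
      (φ x * y * d + φ y * x * φ d + φ z * z * -(d * φ d) = 0 ↔
        φ (a * x + α * z) * (b * y + β * z) * d + φ (b * y + β * z) * (a * x + α * z) * φ d +
          φ (γ * z) * (γ * z) * -(d * φ d) = 0)) :
    α = 0 ∧ β = 0 ∧ φ a * b = φ γ * γ := by
  have hφd : φ d ≠ 0 := by simpa using hd
  obtain ⟨w, hw⟩ := exists_add_conj_eq hφ hφ1
    (t := φ γ * γ * (d * φ d)) (by simp only [map_mul, hφ]; ring)
  have hα : α = 0 := by
    by_contra hα
    have hφα : φ α ≠ 0 := by simpa using hα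
    have := (h 0 ((w / (φ α * d) - β) / b) 1 (fun e => by simpa using congrFun e 2)).mpr (by
      have e : b * ((w / (φ α * d) - β) / b) + β * 1 = w / (φ α * d) := by field_simp; ring
      rw [e]
      simp only [mul_zero, zero_add, mul_one, map_div₀, map_mul, hφ]
      field_simp
      linear_combination hw)
    simp [hd] at this
  have hβ : β = 0 := by
    by_contra hβ
    have hφβ : φ β ≠ 0 := by simpa using hβ
    have := (h ((w / (φ β * φ d) - α) / a) 0 1 (fun e => by simpa using congrFun e 2)).mpr (by
      have e : a * ((w / (φ β * φ d) - α) / a) + α * 1 = w / (φ β * φ d) := by field_simp; ring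
      rw [e]
      simp only [mul_zero, zero_add, mul_one, map_div₀, map_mul, hφ]
      field_simp
      linear_combination hw)
    simp [hd] at this
  refine ⟨hα, hβ, ?_⟩
  have := mul_eq_of_add_conj hφ hφ1 (t := φ a * b) (m := d * φ d) (m' := φ γ * γ * (d * φ d))
    (by simp only [map_mul, hφ]; ring) (fun s hs => by
      have h1 := (h 1 (s / d) 1 (fun e => by simpa using congrFun e 2)).mp (by
        simp only [map_one, map_div₀]
        field_simp
        linear_combination hs)
      subst hα hβ
      simp only [map_mul, map_add, map_div₀, hφ, map_one, map_zero] at h1 ⊢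
      field_simp at h1
      linear_combination h1)
  exact mul_right_cancel₀ (mul_ne_zero hd hφd) this

end Trace

section Projective

variable {F : Type} [Field F]

lemma mk_eq_mk_iff_exists_smul {g g' : Matrix.GeneralLinearGroup (Fin 3) F} :
    (QuotientGroup.mk g : Matrix.GeneralLinearGroup (Fin 3) F ⧸
      Subgroup.center (Matrix.GeneralLinearGroup (Fin 3) F)) = QuotientGroup.mk g' ↔
      ∃ c : F, c ≠ 0 ∧ g.val = c • g'.val := by
  rw [eq_comm, QuotientGroup.eq, Matrix.GeneralLinearGroup.center_eq_range_scalar]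
  constructor
  · rintro ⟨c, hc⟩
    refine ⟨c, c.ne_zero, ?_⟩
    have : g = g' * Matrix.GeneralLinearGroup.scalar (Fin 3) c := by
      rw [hc, mul_inv_cancel_left]
    rw [this, ← Matrix.GeneralLinearGroup.scalar_commute, Matrix.GeneralLinearGroup.coe_mul,
      Matrix.GeneralLinearGroup.coe_scalar, Matrix.scalar_apply, ← Matrix.smul_eq_diagonal_mul]
  · rintro ⟨c, hc, h⟩
    refine ⟨Units.mk0 c hc, ?_⟩
    rw [eq_inv_mul_iff_mul_eq, ← Matrix.GeneralLinearGroup.scalar_commute]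
    apply Units.ext
    rw [h, Matrix.GeneralLinearGroup.coe_mul, Matrix.GeneralLinearGroup.coe_scalar,
      Matrix.scalar_apply, ← Matrix.smul_eq_diagonal_mul, Units.val_mk0]

/-- The homomorphism `u ↦ diag(u, u⁻ᵠ, 1)`. -/
def diagTorus (q : ℕ) : Fˣ →* Matrix.GeneralLinearGroup (Fin 3) F :=
  MonoidHom.toHomUnits
    { toFun := fun u => Matrix.diagonal ![(u : F), (((u ^ q)⁻¹ : Fˣ) : F), 1]
      map_one' := by
        rw [← Matrix.diagonal_one]
        congr 1
        ext i
        fin_cases i <;> simp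
      map_mul' := fun u v => by
        rw [Matrix.diagonal_mul_diagonal]
        congr 1
        ext i
        fin_cases i <;> simp [mul_pow, mul_comm] }

lemma diagTorus_val (q : ℕ) (u : Fˣ) :
    (diagTorus q u).val = Matrix.diagonal ![(u : F), (((u ^ q)⁻¹ : Fˣ) : F), 1] := rfl

/-- The homomorphism sending `u` to the projectivity with matrix `diag(u, u⁻ᵠ, 1)` in the
frame `B`. -/
def frameTorus (q : ℕ) (B : Matrix.GeneralLinearGroup (Fin 3) F) :
    Fˣ →* Matrix.GeneralLinearGroup (Fin 3) F ⧸
      Subgroup.center (Matrix.GeneralLinearGroup (Fin 3) F) :=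
  (QuotientGroup.mk' _).comp ((MulAut.conj B).toMonoidHom.comp (diagTorus q))

lemma frameTorus_apply (q : ℕ) (B : Matrix.GeneralLinearGroup (Fin 3) F) (u : Fˣ) :
    frameTorus q B u = QuotientGroup.mk (B * diagTorus q u * B⁻¹) := rfl

lemma frameTorus_injective (q : ℕ) (B : Matrix.GeneralLinearGroup (Fin 3) F) :
    Function.Injective (frameTorus q B) := by
  rw [injective_iff_map_eq_one]
  intro u hu
  rw [frameTorus_apply, ← QuotientGroup.mk_one, mk_eq_mk_iff_exists_smul] at hu
  obtain ⟨c, -, hc⟩ := hu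
  have h : B.val * (diagTorus q u).val = c • B.val := by
    have := congrArg (· * B.val) hc
    simpa [mul_assoc] using this
  have h' : (diagTorus q u).val = c • (1 : Matrix (Fin 3) (Fin 3) F) := by
    have := congrArg (B⁻¹.val * ·) h
    simpa [← mul_assoc, -Matrix.coe_units_inv] using this
  rw [diagTorus_val] at h'
  have h0 : (u : F) = c := by simpa using congrFun (congrFun h' 0) 0
  have h2 : 1 = c := by simpa using congrFun (congrFun h' 2) 2
  exact Units.ext (by rw [h0, ← h2, Units.val_one])

/-- A projectivity represented by `g` lies on the torus as soon as `g` is a multiple of a torus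
element in the frame `B`. -/
lemma frameTorus_eq_mk {q : ℕ} {B g : Matrix.GeneralLinearGroup (Fin 3) F} {u : Fˣ} {c : F}
    (hc : c ≠ 0) (h : g.val * B.val = c • (B.val * (diagTorus q u).val)) :
    frameTorus q B u = QuotientGroup.mk g := by
  rw [frameTorus_apply, eq_comm, mk_eq_mk_iff_exists_smul]
  refine ⟨c, hc, ?_⟩
  have := congrArg (· * B⁻¹.val) h
  simpa [mul_assoc, -Matrix.coe_units_inv] using this

lemma conj_diagTorus_mulVec (q : ℕ) (B : Matrix.GeneralLinearGroup (Fin 3) F) (u : Fˣ)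
    (x y z : F) :
    (B * diagTorus q u * B⁻¹).val *ᵥ (B.val *ᵥ ![x, y, z]) =
      B.val *ᵥ ![u * x, ((u ^ q)⁻¹ : Fˣ) * y, z] := by
  rw [Matrix.mulVec_mulVec, ← Matrix.GeneralLinearGroup.coe_mul, inv_mul_cancel_right,
    Matrix.GeneralLinearGroup.coe_mul, ← Matrix.mulVec_mulVec, diagTorus_val]
  congr 1
  ext i
  fin_cases i <;> simp [Matrix.mulVec_diagonal]

end Projective

section Fermat

variable {F : Type} [Field F] {q : ℕ}

lemma fermatEval_eq_sesqForm {φ : F →+* F} (hφq : ∀ x, φ x = x ^ q) (v : Fin 3 → F) :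
    fermatEval q v = sesqForm φ v v := by
  simp only [fermatEval, sesqForm, hφq, pow_succ]

lemma fermatEval_smul (c : F) (v : Fin 3 → F) :
    fermatEval q (c • v) = c ^ (q + 1) * fermatEval q v := by
  simp only [fermatEval, Pi.smul_apply, smul_eq_mul, mul_pow]
  ring

lemma fermatEval_comp {K : Type} [Field K] (ι : F →+* K) (v : Fin 3 → F) :
    fermatEval q (ι ∘ v) = ι (fermatEval q v) := by
  simp [fermatEval]

lemma fermatEval_eq_zero_iff_of_algebraMap {K : Type} [Field K] [Algebra F K]
    {g g' : Matrix (Fin 3) (Fin 3) F} {c : F} (hc : c ≠ 0) (hg : g = c • g')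
    (h : ∀ v : Fin 3 → K, v ≠ 0 →
        (fermatEval q v = 0 ↔ fermatEval q ((g.map (algebraMap F K)).mulVec v) = 0))
    {v : Fin 3 → F} (hv : v ≠ 0) : fermatEval q v = 0 ↔ fermatEval q (g'.mulVec v) = 0 := by
  have hv' : algebraMap F K ∘ v ≠ 0 := by
    intro e
    apply hv
    ext i
    simpa using congrFun e i
  have := h _ hv'
  have e : g.map (algebraMap F K) *ᵥ (algebraMap F K ∘ v) = algebraMap F K ∘ (g *ᵥ v) :=
    funext fun i => (RingHom.map_mulVec _ _ _ i).symm
  rw [e] at this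
  simpa [fermatEval_comp, hg, Matrix.smul_mulVec, fermatEval_smul, hc] using this

end Fermat

section Stabilizer

/-- `P`, `Q` are isotropic, `R` is orthogonal to both, and the Gram matrix of the frame
`P, Q, R` is `!![0, d, 0; φ d, 0, 0; 0, 0, -d * φ d]` with `d ≠ 0`. -/
structure IsHyperbolicFrame {F : Type} [Field F] (φ : F →+* F) (P Q R : Fin 3 → F) : Prop where
  left_self : sesqForm φ P P = 0
  right_self : sesqForm φ Q Q = 0
  left_pole : sesqForm φ P R = 0
  pole_left : sesqForm φ R P = 0
  right_pole : sesqForm φ Q R = 0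
  pole_right : sesqForm φ R Q = 0
  ne_zero : sesqForm φ P Q ≠ 0
  swap : sesqForm φ Q P = φ (sesqForm φ P Q)
  pole_self : sesqForm φ R R = -(sesqForm φ P Q * φ (sesqForm φ P Q))

variable {F : Type} [Field F] {φ : F →+* F}

lemma isHyperbolicFrame_linePole (hφ : ∀ x, φ (φ x) = x) {P Q : Fin 3 → F} (hP0 : P ≠ 0)
    (hP : sesqForm φ P P = 0) (hQ : sesqForm φ Q Q = 0) (hPQ : ∀ c : F, Q ≠ c • P) :
    IsHyperbolicFrame φ P Q (linePole φ P Q) where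
  left_self := hP
  right_self := hQ
  left_pole := sesqForm_left_linePole P Q
  pole_left := by rw [sesqForm_swap hφ, sesqForm_left_linePole, map_zero]
  right_pole := sesqForm_right_linePole P Q
  pole_right := by rw [sesqForm_swap hφ, sesqForm_right_linePole, map_zero]
  ne_zero := sesqForm_ne_zero hφ hP0 hP hQ hPQ
  swap := sesqForm_swap hφ P Q
  pole_self := sesqForm_linePole_self hφ hP

variable {q : ℕ} {P Q R : Fin 3 → F} {B : Matrix.GeneralLinearGroup (Fin 3) F}

lemma IsHyperbolicFrame.fermatEval_mulVec (hR : IsHyperbolicFrame φ P Q R)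
    (hφq : ∀ x, φ x = x ^ q) (hB : B.val = frameMatrix P Q R) {K : Type} [Field K]
    {ψ : K →+* K} (hψq : ∀ x, ψ x = x ^ q) (ι : F →+* K) (x y z : K) :
    fermatEval q (B.val.map ι *ᵥ ![x, y, z]) =
      ψ x * y * ι (sesqForm φ P Q) + ψ y * x * ι (sesqForm φ Q P) +
        ψ z * z * ι (sesqForm φ R R) := by
  have hmap : B.val.map ι = frameMatrix (ι ∘ P) (ι ∘ Q) (ι ∘ R) := by
    rw [hB]
    ext i j
    fin_cases i <;> fin_cases j <;> simp [frameMatrix]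
  have hform : ∀ v w : Fin 3 → F, sesqForm ψ (ι ∘ v) (ι ∘ w) = ι (sesqForm φ v w) := by
    intro v w
    simp [sesqForm, hφq, hψq]
  rw [fermatEval_eq_sesqForm hψq, hmap, sesqForm_frameMatrix_mulVec] <;>
    simp [hform, hR.left_self, hR.right_self, hR.left_pole, hR.pole_left, hR.right_pole,
      hR.pole_right]

/-- Torus elements preserve the Hermitian polynomial over every extension field. -/
lemma IsHyperbolicFrame.fermatEval_torus_mulVec (hR : IsHyperbolicFrame φ P Q R)
    (hφ : ∀ x, φ (φ x) = x)
    (hφq : ∀ x, φ x = x ^ q) (hB : B.val = frameMatrix P Q R) {K : Type} [Field K]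
    {ψ : K →+* K} (hψq : ∀ x, ψ x = x ^ q) (ι : F →+* K) (u : Fˣ) (v : Fin 3 → K) :
    fermatEval q ((B * diagTorus q u * B⁻¹).val.map ι *ᵥ v) = fermatEval q v := by
  set c : Fin 3 → K := (B⁻¹).val.map ι *ᵥ v with hc
  have hv : v = B.val.map ι *ᵥ ![c 0, c 1, c 2] := by
    have : ![c 0, c 1, c 2] = c := by ext i; fin_cases i <;> rfl
    rw [this, hc, Matrix.mulVec_mulVec, ← Matrix.map_mul, ← Matrix.GeneralLinearGroup.coe_mul,
      mul_inv_cancel, Matrix.GeneralLinearGroup.coe_one,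
      Matrix.map_one _ (map_zero ι) (map_one ι), Matrix.one_mulVec]
  have hg : (B * diagTorus q u * B⁻¹).val.map ι *ᵥ v =
      B.val.map ι *ᵥ ![ι u * c 0, ι ((u ^ q)⁻¹ : Fˣ) * c 1, c 2] := by
    rw [Matrix.GeneralLinearGroup.coe_mul, Matrix.GeneralLinearGroup.coe_mul, Matrix.map_mul,
      Matrix.map_mul, ← Matrix.mulVec_mulVec, ← hc, ← Matrix.mulVec_mulVec, diagTorus_val,
      Matrix.diagonal_map (map_zero ι)]
    congr 1
    ext i
    fin_cases i <;> simp [Matrix.mulVec_diagonal]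
  rw [hg, hR.fermatEval_mulVec hφq hB hψq]
  conv_rhs => rw [hv, hR.fermatEval_mulVec hφq hB hψq]
  have hψ : ∀ x : F, ψ (ι x) = ι (φ x) := fun x => by rw [hψq, hφq, map_pow]
  have h1 : φ (u : F) * ((u ^ q)⁻¹ : Fˣ) = 1 := by
    rw [hφq, ← Units.val_pow_eq_pow_val, Units.mul_inv]
  have h2 : φ ((u ^ q)⁻¹ : Fˣ) * (u : F) = 1 := by
    simpa [hφ] using congrArg φ ((mul_comm _ _).trans h1)
  simp only [map_mul, hψ]
  have h1' := congrArg ι h1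
  have h2' := congrArg ι h2
  rw [map_mul, map_one] at h1' h2'
  linear_combination (ψ (c 0) * c 1 * ι (sesqForm φ P Q)) * h1' +
    (ψ (c 1) * c 0 * ι (sesqForm φ Q P)) * h2'

/-- Projectivities fixing `P` and `Q` and preserving rational isotropic points lie on the torus. -/
lemma IsHyperbolicFrame.exists_frameTorus_eq (hR : IsHyperbolicFrame φ P Q R)
    (hφ : ∀ x, φ (φ x) = x) (hφ1 : ∃ x, φ x ≠ x)
    (hφq : ∀ x, φ x = x ^ q) (hB : B.val = frameMatrix P Q R)
    {g : Matrix.GeneralLinearGroup (Fin 3) F} {a b : F}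
    (hgP : g.val *ᵥ P = a • P) (hgQ : g.val *ᵥ Q = b • Q)
    (hg : ∀ v : Fin 3 → F, v ≠ 0 → (fermatEval q v = 0 ↔ fermatEval q (g.val *ᵥ v) = 0)) :
    ∃ u, frameTorus q B u = QuotientGroup.mk g := by
  set c : Fin 3 → F := (B⁻¹).val *ᵥ (g.val *ᵥ R) with hc
  have hgR : g.val *ᵥ R = c 0 • P + c 1 • Q + c 2 • R := by
    rw [← frameMatrix_mulVec, ← hB, hc, Matrix.mulVec_mulVec,
      ← Matrix.GeneralLinearGroup.coe_mul, mul_inv_cancel, Matrix.GeneralLinearGroup.coe_one,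
      Matrix.one_mulVec]
  have hgB : ∀ x y z : F, g.val *ᵥ (B.val *ᵥ ![x, y, z]) =
      B.val *ᵥ ![a * x + c 0 * z, b * y + c 1 * z, c 2 * z] := by
    intro x y z
    rw [hB, frameMatrix_mulVec, frameMatrix_mulVec]
    simp only [Matrix.mulVec_add, Matrix.mulVec_smul, hgP, hgQ, hgR, Matrix.cons_val_zero,
      Matrix.cons_val_one, Matrix.cons_val]
    module
  have hmat : g.val * B.val = B.val * !![a, 0, c 0; 0, b, c 1; 0, 0, c 2] := by
    apply Matrix.toLin'.injective
    apply LinearMap.ext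
    intro v
    have hv : v = ![v 0, v 1, v 2] := by ext i; fin_cases i <;> rfl
    rw [Matrix.toLin'_apply, Matrix.toLin'_apply, ← Matrix.mulVec_mulVec, ← Matrix.mulVec_mulVec,
      hv, hgB]
    congr 1
    ext i
    fin_cases i <;> simp [Matrix.mulVec, dotProduct, Fin.sum_univ_three]
  have hdet : a * b * c 2 ≠ 0 := by
    have h := congrArg Matrix.det hmat
    rw [Matrix.det_mul, Matrix.det_mul, mul_comm] at h
    have h' := mul_left_cancel₀ (Matrix.GeneralLinearGroup.det_ne_zero B) h
    have hgdet := Matrix.GeneralLinearGroup.det_ne_zero g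
    rw [h', Matrix.det_fin_three] at hgdet
    simpa using hgdet
  obtain ⟨hab, hγ⟩ := mul_ne_zero_iff.mp hdet
  obtain ⟨ha, hb⟩ := mul_ne_zero_iff.mp hab
  have hfe : ∀ x y z : F, fermatEval q (B.val *ᵥ ![x, y, z]) =
      φ x * y * sesqForm φ P Q + φ y * x * φ (sesqForm φ P Q) +
        φ z * z * -(sesqForm φ P Q * φ (sesqForm φ P Q)) := by
    intro x y z
    have := hR.fermatEval_mulVec hφq hB hφq (RingHom.id F) x y z
    simpa [hR.swap, hR.pole_self] using this
  obtain ⟨hα, hβ, hγn⟩ := diagonal_of_preserves_isotropic hφ hφ1 hR.ne_zero ha hb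
    (α := c 0) (β := c 1) (γ := c 2) (by
      intro x y z hxyz
      rw [← hfe, ← hfe, ← hgB]
      apply hg
      intro h0
      apply hxyz
      have := congrArg ((B⁻¹).val *ᵥ ·) h0
      simpa only [Matrix.mulVec_mulVec, ← Matrix.GeneralLinearGroup.coe_mul, inv_mul_cancel,
        Matrix.GeneralLinearGroup.coe_one, Matrix.one_mulVec, Matrix.mulVec_zero] using this)
  refine ⟨Units.mk0 (a / c 2) (div_ne_zero ha hγ), frameTorus_eq_mk hγ ?_⟩
  rw [hmat, ← Matrix.mul_smul, diagTorus_val]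
  congr 1
  have hb' : b = c 2 * ((a / c 2) ^ q)⁻¹ := by
    rw [hφq, hφq] at hγn
    rw [div_pow, inv_div]
    field_simp
    linear_combination hγn
  ext i j
  fin_cases i <;> fin_cases j <;> simp [hα, hβ]
  · field_simp
  · simpa using hb'

lemma isHomologyWithAxis_frameTorus_iff (hB : B.val = frameMatrix P Q R) (u : Fˣ) :
    IsHomologyWithAxis (frameTorus q B u) P Q ↔ u ≠ 1 ∧ u ^ (q + 1) = 1 := by
  have hB' : ∀ x y z : F, B.val *ᵥ ![x, y, z] = x • P + y • Q + z • R := by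
    intro x y z
    rw [hB, frameMatrix_mulVec]
    rfl
  have hinj : Function.Injective (fun c : Fin 3 → F => B.val *ᵥ c) := by
    intro c c' h
    have := congrArg ((B⁻¹).val *ᵥ ·) h
    simpa only [Matrix.mulVec_mulVec, ← Matrix.GeneralLinearGroup.coe_mul, inv_mul_cancel,
      Matrix.GeneralLinearGroup.coe_one, Matrix.one_mulVec] using this
  have hT := conj_diagTorus_mulVec q B u
  rw [IsHomologyWithAxis, ← map_one (frameTorus q B), (frameTorus_injective q B).ne_iff]
  refine and_congr_right fun _ => ⟨?_, fun hu => ?_⟩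
  · rintro ⟨g, hg, haxis, -⟩
    rw [frameTorus_apply, mk_eq_mk_iff_exists_smul] at hg
    obtain ⟨c, hc, hg⟩ := hg
    obtain ⟨k, hk⟩ := haxis (P + Q) (Submodule.mem_span_pair.mpr ⟨1, 1, by simp⟩)
    have h1 : P + Q = B.val *ᵥ ![1, 1, 0] := by simp [hB']
    have h2 := hT 1 1 0
    rw [← h1, hg, Matrix.smul_mulVec, hk, h1, ← Matrix.mulVec_smul, ← Matrix.mulVec_smul] at h2
    have h3 := hinj h2
    have e0 : c * k = u := by simpa using congrFun h3 0
    have e1 : c * k = ((u ^ q)⁻¹ : Fˣ) := by simpa using congrFun h3 1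
    have : u = (u ^ q)⁻¹ := Units.ext (e0.symm.trans e1)
    rw [pow_succ']
    nth_rewrite 1 [this]
    exact inv_mul_cancel _
  · have hu' : (u ^ q)⁻¹ = u := by
      rw [inv_eq_iff_mul_eq_one, ← pow_succ, hu]
    rw [hu'] at hT
    refine ⟨_, frameTorus_apply q B u, fun v hv => ?_, R, fun hmem => ?_, fun v => ?_⟩
    · obtain ⟨x, y, rfl⟩ := Submodule.mem_span_pair.mp hv
      refine ⟨u, ?_⟩
      have := hT x y 0
      simp only [hB', zero_smul, add_zero] at this
      rw [this]
      module
    · obtain ⟨x, y, h⟩ := Submodule.mem_span_pair.mp hmem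
      have : B.val *ᵥ ![x, y, 0] = B.val *ᵥ ![0, 0, 1] := by simp [hB', h]
      simpa using congrFun (hinj this) 2
    · obtain ⟨c, rfl⟩ : ∃ c, B.val *ᵥ c = v := ⟨(B⁻¹).val *ᵥ v, by
        rw [Matrix.mulVec_mulVec, ← Matrix.GeneralLinearGroup.coe_mul, mul_inv_cancel,
          Matrix.GeneralLinearGroup.coe_one, Matrix.one_mulVec]⟩
      have hcc : c = ![c 0, c 1, c 2] := by ext i; fin_cases i <;> rfl
      rw [hcc, hT, Submodule.mem_span_pair]
      refine ⟨(1 - u) * c 2, u, ?_⟩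
      rw [hB', hB']
      module

end Stabilizer

section Counting

variable {F : Type} [Field F] [Fintype F] {q : ℕ}

lemma ncard_units_pow_eq_one_and_ne_one (hF : Fintype.card F = q ^ 2) (hq : 1 < q) :
    {u : Fˣ | u ≠ 1 ∧ u ^ (q + 1) = 1}.ncard = q := by
  have hcard : Nat.card Fˣ = (q + 1) * (q - 1) := by
    classical
    rw [Nat.card_eq_fintype_card, Fintype.card_units, hF, ← Nat.sq_sub_sq, one_pow]
  have hker := IsCyclic.card_powMonoidHom_ker (G := Fˣ) (q + 1)
  rw [hcard, Nat.gcd_eq_right (dvd_mul_right _ _)] at hker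
  have e : {u : Fˣ | u ≠ 1 ∧ u ^ (q + 1) = 1} =
      ((powMonoidHom (q + 1) : Fˣ →* Fˣ).ker : Set Fˣ) \ {1} := by
    ext u
    simp [MonoidHom.mem_ker, and_comm]
  rw [e, Set.ncard_sdiff_singleton_of_mem (one_mem _)]
  change Nat.card _ - 1 = q
  rw [SetLike.coe_sort_coe, hker]
  omega

lemma exists_pow_ne_self (hF : Fintype.card F = q ^ 2) (hq : 1 < q) : ∃ x : F, x ^ q ≠ x := by
  by_contra! h
  have h1 : ∀ x : Fˣ, x ^ (q - 1) = 1 := by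
    intro x
    have hx : x ^ (q - 1) * x = x := by
      rw [← pow_succ, Nat.sub_add_cancel hq.le]
      exact Units.ext (by simpa using h x)
    simpa using hx
  have h2 := (FiniteField.forall_pow_eq_one_iff F (q - 1)).mp h1
  rw [hF] at h2
  have h3 := Nat.le_of_dvd (by omega) h2
  have : q * 2 ≤ q ^ 2 := by rw [sq]; exact Nat.mul_le_mul_left q hq
  omega

lemma charP_of_card_eq_prime_pow_sq {p h : ℕ} (hp : p.Prime) (hh : 1 ≤ h)
    (hF : Fintype.card F = (p ^ h) ^ 2) : CharP F p := by
  obtain ⟨p', hp'⟩ := CharP.exists F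
  obtain ⟨n, hn, hcard⟩ := FiniteField.card F p'
  have : p' = p := by
    rw [hF, ← pow_mul] at hcard
    have : p ∣ p' ^ (n : ℕ) := hcard ▸ dvd_pow_self p (by omega)
    exact ((Nat.prime_dvd_prime_iff_eq hp hn).mp (hp.dvd_of_dvd_pow this)).symm
  exact this ▸ hp'

end Counting

/-- Let `P, Q` be distinct `𝔽_{q²}`-rational points of the Hermitian
curve `𝓗_q`.  The subgroup of `PGU(3,q)` fixing `P` and `Q` has order `q² - 1`, and
exactly `q` of its `q² - 2` nontrivial elements are homologies with axis `PQ`. -/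
theorem stmt_15 (p : ℕ) (hp : p.Prime) (h : ℕ) (hh : 1 ≤ h) (q : ℕ) (hq : q = p ^ h)
    (F : Type) [Field F] [Fintype F] (hF : Fintype.card F = q ^ 2)
    (K : Type) [Field K] [IsAlgClosed K] [Algebra F K]
    (PGU : Subgroup (Matrix.GeneralLinearGroup (Fin 3) F ⧸
      Subgroup.center (Matrix.GeneralLinearGroup (Fin 3) F)))
    (hPGU : ∀ gbar, gbar ∈ PGU ↔ ∃ g : Matrix.GeneralLinearGroup (Fin 3) F,
      gbar = QuotientGroup.mk g ∧ ∀ v : Fin 3 → K, v ≠ 0 →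
        (fermatEval q v = 0 ↔
          fermatEval q (((g : Matrix (Fin 3) (Fin 3) F).map (algebraMap F K)).mulVec v) = 0))
    (P Q : Fin 3 → F) (hP0 : P ≠ 0) (hQ0 : Q ≠ 0)
    (hP : fermatEval q P = 0) (hQ : fermatEval q Q = 0)
    (hPQ : ∀ c : F, Q ≠ c • P)
    (S : Set (Matrix.GeneralLinearGroup (Fin 3) F ⧸
      Subgroup.center (Matrix.GeneralLinearGroup (Fin 3) F)))
    (hS : S = {gbar | gbar ∈ PGU ∧ ∃ g : Matrix.GeneralLinearGroup (Fin 3) F,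
      gbar = QuotientGroup.mk g ∧
      (∃ c : F, (g : Matrix (Fin 3) (Fin 3) F).mulVec P = c • P) ∧
      (∃ c : F, (g : Matrix (Fin 3) (Fin 3) F).mulVec Q = c • Q)}) :
    S.ncard = q ^ 2 - 1 ∧
    Set.ncard {gbar ∈ S | gbar ≠ 1} = q ^ 2 - 2 ∧
    Set.ncard {gbar ∈ S | IsHomologyWithAxis gbar P Q} = q := by
  subst hq
  have hq1 : 1 < p ^ h := Nat.one_lt_pow (by omega) hp.one_lt
  have : Fact p.Prime := ⟨hp⟩
  have : CharP F p := charP_of_card_eq_prime_pow_sq hp hh hF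
  have : CharP K p := charP_of_injective_algebraMap (algebraMap F K).injective p
  set q := p ^ h with hq
  set φ : F →+* F := iterateFrobenius F p h
  have hφq : ∀ x, φ x = x ^ q := fun x => iterateFrobenius_def p h x
  have hψq : ∀ x : K, iterateFrobenius K p h x = x ^ q := fun x => iterateFrobenius_def p h x
  have hφ : ∀ x, φ (φ x) = x := fun x => by
    rw [hφq, hφq, ← pow_mul, ← sq, ← hF, FiniteField.pow_card]
  have hφ1 : ∃ x, φ x ≠ x := by simpa only [hφq] using exists_pow_ne_self hF hq1
  rw [fermatEval_eq_sesqForm hφq] at hP hQ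
  have hR := isHyperbolicFrame_linePole hφ hP0 hP hQ hPQ
  have hdet : (frameMatrix P Q (linePole φ P Q)).det ≠ 0 := by
    rw [det_frameMatrix_linePole hφ hP]
    simpa using hR.ne_zero
  set B := Matrix.GeneralLinearGroup.mkOfDetNeZero _ hdet
  have hB : B.val = frameMatrix P Q (linePole φ P Q) := rfl
  have hBP : P = B.val *ᵥ ![1, 0, 0] := by simp [hB, frameMatrix_mulVec]
  have hBQ : Q = B.val *ᵥ ![0, 1, 0] := by simp [hB, frameMatrix_mulVec]
  have hrange : S = Set.range (frameTorus q B) := by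
    rw [hS]
    ext gbar
    constructor
    · rintro ⟨hmem, g, rfl, ⟨a, ha⟩, b, hb⟩
      obtain ⟨g', hg', hpres⟩ := (hPGU _).mp hmem
      obtain ⟨c, hc, hgg'⟩ := mk_eq_mk_iff_exists_smul.mp hg'.symm
      exact hR.exists_frameTorus_eq hφ hφ1 hφq hB ha hb fun v hv =>
        fermatEval_eq_zero_iff_of_algebraMap hc hgg' hpres hv
    · rintro ⟨u, rfl⟩
      refine ⟨(hPGU _).mpr ⟨_, frameTorus_apply q B u, fun v _ => ?_⟩,
        _, frameTorus_apply q B u, ⟨u, ?_⟩, ((u ^ q)⁻¹ : Fˣ), ?_⟩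
      · rw [hR.fermatEval_torus_mulVec hφ hφq hB hψq]
      · rw [hBP, conj_diagTorus_mulVec, ← Matrix.mulVec_smul]
        simp
      · rw [hBQ, conj_diagTorus_mulVec, ← Matrix.mulVec_smul]
        simp
  have hinj := frameTorus_injective q B
  have hcard : S.ncard = q ^ 2 - 1 := by
    classical
    rw [hrange, Set.ncard_range_of_injective hinj, Nat.card_eq_fintype_card,
      Fintype.card_units, hF]
  refine ⟨hcard, ?_, ?_⟩
  · have e : {gbar ∈ S | gbar ≠ 1} = S \ {1} := by
      ext gbar
      simp
    rw [e, Set.ncard_sdiff_singleton_of_mem (hrange ▸ ⟨1, map_one _⟩), hcard]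
    omega
  · have e : {gbar ∈ S | IsHomologyWithAxis gbar P Q} =
        frameTorus q B '' {u : Fˣ | u ≠ 1 ∧ u ^ (q + 1) = 1} := by
      rw [hrange]
      ext gbar
      constructor
      · rintro ⟨⟨u, rfl⟩, hu⟩
        exact ⟨u, (isHomologyWithAxis_frameTorus_iff hB u).mp hu, rfl⟩
      · rintro ⟨u, hu, rfl⟩
        exact ⟨⟨u, rfl⟩, (isHomologyWithAxis_frameTorus_iff hB u).mpr hu⟩
    rw [e, Set.ncard_image_of_injective _ hinj, ncard_units_pow_eq_one_and_ne_one hF hq1]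
end
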